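/- Let P = (p_0:p_1:p_2) be a point with m_P(C) = 2 and let m ≥ 1. Then P is an A_{2m} singularity (i.e., the completion of O_{C,P} is isomorphic as a K-algebra to K[[u,v]]/(v² − u^{2m+1})) if and only if: (i) G_P = L² for a linear form L ∈ K[s,t], and (ii) m is the largest integer t ≥ 1 such that the local ring at P of the homogeneous ideal J_t ⊆ K[w_0,w_1,w_2] generated by all homogeneous h with L^{2t} dividing h(f_0,f_1,f_2) is isomorphic as a K-algebra to K[u]/(u^t) (i.e., the image under f of the order-2t neighborhood of the unique preimage of P is a curvilinear scheme of length t). -/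

import Mathlib

open MvPolynomial

noncomputable section

/-- The coefficient `a_i` of `s^(n-i) t^i` in a binary form `f` of degree `n`. -/
def bcoeff {K : Type*} [Field K] (n : ℕ) (f : MvPolynomial (Fin 2) K) (i : Fin (n + 1)) : K :=
  MvPolynomial.coeff (Finsupp.single 0 (n - (i : ℕ)) + Finsupp.single 1 (i : ℕ)) f

/-- The binary form of degree `k` with coefficient vector `x`. -/
def formOf {K : Type*} [Field K] (k : ℕ) (x : Fin (k + 1) → K) : MvPolynomial (Fin 2) K :=
  ∑ i : Fin (k + 1),
    MvPolynomial.C (x i) * MvPolynomial.X 0 ^ (k - (i : ℕ)) * MvPolynomial.X 1 ^ (i : ℕ)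

/-- The matrix `M_k` associated to the parameterization `f`: the first `n-k+1` rows contain
the variables `x_0, …, x_k` in staircase position, the last three rows are the coefficient
vectors of `f_0, f_1, f_2`. -/
def Mmat {K : Type*} [Field K] (n k : ℕ) (f : Fin 3 → MvPolynomial (Fin 2) K) :
    Matrix (Fin (n - k + 4)) (Fin (n + 1)) (MvPolynomial (Fin (k + 1)) K) :=
  fun j c =>
    if hj : (j : ℕ) ≤ n - k then
      if h : (j : ℕ) ≤ (c : ℕ) ∧ (c : ℕ) ≤ (j : ℕ) + k then
        MvPolynomial.X ⟨(c : ℕ) - (j : ℕ), by omega⟩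
      else 0
    else
      MvPolynomial.C (bcoeff n (f ⟨(j : ℕ) - (n - k + 1), by have := j.isLt; omega⟩) c)

/-- The set of `(n-k+3) × (n-k+3)` minors of the matrix `M_k`; it generates the ideal
`I_{X_k}`. -/
def minorsSet {K : Type*} [Field K] (n k : ℕ) (f : Fin 3 → MvPolynomial (Fin 2) K) :
    Set (MvPolynomial (Fin (k + 1)) K) :=
  { g | ∃ (r : Fin (n - k + 3) → Fin (n - k + 4)) (c : Fin (n - k + 3) → Fin (n + 1)),
      Function.Injective r ∧ Function.Injective c ∧
      g = ((Mmat n k f).submatrix r c).det }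

/-- The projective zero locus `X_k(K) ⊆ ℙ^k(K)` of the ideal of minors of `M_k`. -/
def XkSet {K : Type*} [Field K] (n k : ℕ) (f : Fin 3 → MvPolynomial (Fin 2) K) :
    Set (Projectivization K (Fin (k + 1) → K)) :=
  { P | ∀ g ∈ minorsSet n k f, MvPolynomial.eval P.rep g = 0 }

/-- Evaluation of the parameterization at a vector `v ∈ K²`. -/
def evalVec {K : Type*} [Field K] (f : Fin 3 → MvPolynomial (Fin 2) K) (v : Fin 2 → K) :
    Fin 3 → K :=
  fun u => MvPolynomial.eval v (f u)

/-- The induced map `f : ℙ¹(K) → ℙ²(K)` (with a junk value where undefined). -/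
def projMap {K : Type*} [Field K] (f : Fin 3 → MvPolynomial (Fin 2) K)
    (P : Projectivization K (Fin 2 → K)) : Projectivization K (Fin 3 → K) :=
  haveI := Classical.propDecidable (evalVec f P.rep ≠ 0)
  if h : evalVec f P.rep ≠ 0 then Projectivization.mk K _ h
  else Projectivization.mk K (fun _ => 1) (fun hc => one_ne_zero (congrFun hc 0))

/-- `f = (f_0, f_1, f_2)` is a proper parameterization of degree `n`: the `f_u` are
homogeneous of degree `n`, have no common zero outside the origin, and the induced map
`ℙ¹(K) → ℙ²(K)` is injective outside some finite set. -/
structure IsProperParam {K : Type*} [Field K] (n : ℕ)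
    (f : Fin 3 → MvPolynomial (Fin 2) K) : Prop where
  homog : ∀ u, (f u).IsHomogeneous n
  no_common_zero : ∀ v : Fin 2 → K, v ≠ 0 → evalVec f v ≠ 0
  gen_injective : ∃ S : Set (Projectivization K (Fin 2 → K)), S.Finite ∧
    Set.InjOn (projMap f) Sᶜ

/-- The homogeneous vanishing ideal of the point `p ∈ ℙ²(K)`. -/
def pointIdeal {K : Type*} [Field K] (p : Fin 3 → K) : Ideal (MvPolynomial (Fin 3) K) :=
  Ideal.span { L | L.IsHomogeneous 1 ∧ MvPolynomial.eval p L = 0 }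

/-- The multiplicity of the curve `{F = 0}` at the point `p`:
the largest `m` with `F ∈ I(p)^m`. -/
def multAt {K : Type*} [Field K] (F : MvPolynomial (Fin 3) K) (p : Fin 3 → K) : ℕ :=
  sSup { m | F ∈ pointIdeal p ^ m }

/-- The cross difference `p_i f_j - p_j f_i`. -/
def crossDiff {K : Type*} [Field K] (f : Fin 3 → MvPolynomial (Fin 2) K) (p : Fin 3 → K)
    (i j : Fin 3) : MvPolynomial (Fin 2) K :=
  MvPolynomial.C (p i) * f j - MvPolynomial.C (p j) * f i

/-- `G` is a greatest common divisor of the three cross differences `p_i f_j - p_j f_i`,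
`0 ≤ i < j ≤ 2`. -/
def IsGcdOfCross {K : Type*} [Field K] (f : Fin 3 → MvPolynomial (Fin 2) K) (p : Fin 3 → K)
    (G : MvPolynomial (Fin 2) K) : Prop :=
  (∀ i j : Fin 3, i < j → G ∣ crossDiff f p i j) ∧
  (∀ D : MvPolynomial (Fin 2) K, (∀ i j : Fin 3, i < j → D ∣ crossDiff f p i j) → D ∣ G)

/-- The linear binary form with root `v = (v 0 : v 1)`. -/
def linFormOf {K : Type*} [Field K] (v : Fin 2 → K) : MvPolynomial (Fin 2) K :=
  MvPolynomial.C (v 1) * MvPolynomial.X 0 - MvPolynomial.C (v 0) * MvPolynomial.X 1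

/-- The multiplicity of `v` as a root of the binary form `h`. -/
def ordAt {K : Type*} [Field K] (v : Fin 2 → K) (h : MvPolynomial (Fin 2) K) : ℕ :=
  sSup { e | linFormOf v ^ e ∣ h }

/-- The point `x ∈ ℙ²` lies on the conic `4 x₀ x₂ - x₁² = 0`. -/
def onConic {K : Type*} [Field K] (x : Fin 3 → K) : Prop :=
  4 * x 0 * x 2 - x 1 ^ 2 = 0

/-- The embedding of chart indices: the two coordinates other than `c`. -/
def chartEmb (c : Fin 3) (i : Fin 2) : Fin 3 :=
  if (i : ℕ) < (c : ℕ) then ⟨(i : ℕ), by have := i.isLt; omega⟩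
  else ⟨(i : ℕ) + 1, by have := i.isLt; omega⟩

/-- Dehomogenization substitution for the affine chart `{x_c ≠ 0}` of `ℙ²`:
the variable `x_c` is sent to `1`, the other two variables to the affine coordinates. -/
def dehomMap {K : Type*} [Field K] (c : Fin 3) (j : Fin 3) : MvPolynomial (Fin 2) K :=
  if j = c then 1
  else if h2 : (j : ℕ) < (c : ℕ) then MvPolynomial.X ⟨(j : ℕ), by have := c.isLt; omega⟩
  else MvPolynomial.X ⟨(j : ℕ) - 1, by have := j.isLt; omega⟩

/-- The affine coordinates, in the chart `{x_c ≠ 0}`, of the projective point with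
homogeneous coordinates `q`. -/
def affOf {K : Type*} [Field K] (q : Fin 3 → K) (c : Fin 3) : Fin 2 → K :=
  fun i => q (chartEmb c i) / q c

/-- The dehomogenization of a homogeneous ideal of `K[x_0,x_1,x_2]` in the chart
`{x_c ≠ 0}`. -/
def dehomIdeal {K : Type*} [Field K] (c : Fin 3) (I : Ideal (MvPolynomial (Fin 3) K)) :
    Ideal (MvPolynomial (Fin 2) K) :=
  I.map (MvPolynomial.aeval (dehomMap c) : MvPolynomial (Fin 3) K →ₐ[K] MvPolynomial (Fin 2) K)

instance kerEvalMaximal {K : Type*} [Field K] (a : Fin 2 → K) :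
    (RingHom.ker (MvPolynomial.eval a : MvPolynomial (Fin 2) K →+* K)).IsMaximal :=
  RingHom.ker_isMaximal_of_surjective _ (fun r => ⟨MvPolynomial.C r, by simp⟩)

/-- The local ring at the point `a ∈ 𝔸²` of the subscheme of the affine plane defined by the
ideal `I`: the localization, at (the image of) the maximal ideal of `a`, of the quotient of
the affine coordinate ring `K[x,y]` by `I`. -/
def LocalRingAt {K : Type*} [Field K] (I : Ideal (MvPolynomial (Fin 2) K))
    (a : Fin 2 → K) : Type _ :=
  Localization
    (((RingHom.ker (MvPolynomial.eval a : MvPolynomial (Fin 2) K →+* K)).primeCompl).map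
      (Ideal.Quotient.mk I))

noncomputable instance {K : Type*} [Field K] (I : Ideal (MvPolynomial (Fin 2) K))
    (a : Fin 2 → K) : CommRing (LocalRingAt I a) :=
  inferInstanceAs (CommRing (Localization _))

noncomputable instance {K : Type*} [Field K] (I : Ideal (MvPolynomial (Fin 2) K))
    (a : Fin 2 → K) : Algebra K (LocalRingAt I a) :=
  inferInstanceAs (Algebra K (Localization _))

noncomputable instance {K : Type*} [Field K] (I : Ideal (MvPolynomial (Fin 2) K))
    (a : Fin 2 → K) : Algebra (MvPolynomial (Fin 2) K) (LocalRingAt I a) :=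
  inferInstanceAs (Algebra (MvPolynomial (Fin 2) K) (Localization _))

/-- The length at the point `a` of the subscheme of `𝔸²` defined by `I`: the `K`-dimension
of the local ring of the subscheme at `a`. -/
noncomputable def lengthAt {K : Type*} [Field K] (I : Ideal (MvPolynomial (Fin 2) K))
    (a : Fin 2 → K) : ℕ :=
  Module.finrank K (LocalRingAt I a)

/-- The delta invariant `dim_K (Ō/O)` of the local ring `O` at `a` of the plane curve defined
by `I`, computed in a field of fractions `L` of `O`. -/
noncomputable def deltaAt {K : Type*} [Field K] (I : Ideal (MvPolynomial (Fin 2) K))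
    (a : Fin 2 → K) (L : Type*) [Field L] [Algebra (LocalRingAt I a) L]
    [IsFractionRing (LocalRingAt I a) L] [Algebra K L]
    [IsScalarTower K (LocalRingAt I a) L] : ℕ :=
  Module.finrank K
    ((integralClosure (LocalRingAt I a) L) ⧸
      LinearMap.range ((Algebra.linearMap (LocalRingAt I a)
        (integralClosure (LocalRingAt I a) L)).restrictScalars K))

/-- The completion of the local ring at `a` of the plane subscheme defined by `I`, with
respect to its maximal ideal. -/
def LocalCompletion {K : Type*} [Field K] (I : Ideal (MvPolynomial (Fin 2) K))
    (a : Fin 2 → K) : Type _ :=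
  AdicCompletion
    ((RingHom.ker (MvPolynomial.eval a : MvPolynomial (Fin 2) K →+* K)).map
      (algebraMap (MvPolynomial (Fin 2) K) (LocalRingAt I a)))
    (LocalRingAt I a)

noncomputable instance {K : Type*} [Field K] (I : Ideal (MvPolynomial (Fin 2) K))
    (a : Fin 2 → K) : CommRing (LocalCompletion I a) :=
  inferInstanceAs (CommRing (AdicCompletion _ _))

noncomputable instance {K : Type*} [Field K] (I : Ideal (MvPolynomial (Fin 2) K))
    (a : Fin 2 → K) : Algebra (LocalRingAt I a) (LocalCompletion I a) :=
  inferInstanceAs (Algebra _ (AdicCompletion _ _))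

/-- `p` is an `A_s` singularity of the projective plane curve `{F = 0}`: in every affine chart
containing `p`, the completion of the local ring of the curve at `p` is isomorphic, as a
`K`-algebra, to `K[[u,v]]/(v² - u^(s+1))`. -/
def IsAsSing {K : Type*} [Field K] (F : MvPolynomial (Fin 3) K) (p : Fin 3 → K)
    (s : ℕ) : Prop :=
  ∀ c : Fin 3, p c ≠ 0 →
    ∃ e : LocalCompletion (Ideal.span {MvPolynomial.aeval (dehomMap c) F}) (affOf p c) ≃+*
        (MvPowerSeries (Fin 2) K ⧸ Ideal.span
          {(MvPowerSeries.X 1 : MvPowerSeries (Fin 2) K) ^ 2 - MvPowerSeries.X 0 ^ (s + 1)}),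
      ∀ r : K,
        e (algebraMap (LocalRingAt (Ideal.span {MvPolynomial.aeval (dehomMap c) F}) (affOf p c))
            (LocalCompletion (Ideal.span {MvPolynomial.aeval (dehomMap c) F}) (affOf p c))
            (algebraMap K _ r))
          = algebraMap K _ r

/-- The homogeneous ideal of `K[w_0,w_1,w_2]` generated by all homogeneous `h` such that `g`
divides `h(f_0,f_1,f_2)`. -/
def JIdeal {K : Type*} [Field K] (f : Fin 3 → MvPolynomial (Fin 2) K)
    (g : MvPolynomial (Fin 2) K) : Ideal (MvPolynomial (Fin 3) K) :=
  Ideal.span { h | (∃ d : ℕ, h.IsHomogeneous d) ∧ g ∣ MvPolynomial.aeval f h }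

/-- The scheme defined by the homogeneous ideal `J` is, locally at `p`, curvilinear of length
`t`: in every chart containing `p`, the local ring of `J` at `p` is isomorphic as a
`K`-algebra to `K[u]/(u^t)`. -/
def CurvilinearOfLength {K : Type*} [Field K] (J : Ideal (MvPolynomial (Fin 3) K))
    (p : Fin 3 → K) (t : ℕ) : Prop :=
  ∀ c : Fin 3, p c ≠ 0 →
    Nonempty ((LocalRingAt (dehomIdeal c J) (affOf p c)) ≃ₐ[K]
      (Polynomial K ⧸ Ideal.span {(Polynomial.X : Polynomial K) ^ t}))

/-! ### Power series with given orders -/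

theorem aux_unit_order {K : Type*} [Field K] {f : PowerSeries K}
    (h : PowerSeries.constantCoeff f ≠ 0) : f.order = 0 := by
  apply PowerSeries.order_zero_of_unit
  rw [PowerSeries.isUnit_iff_constantCoeff]
  exact isUnit_iff_ne_zero.mpr h

theorem aux_order_pow {K : Type*} [Field K] {α : PowerSeries K} {e : ℕ} (h : α.order = e) (k : ℕ) :
    (α ^ k).order = (k * e : ℕ) := by
  rw [PowerSeries.order_pow, h]; simp

theorem aux_order_aeval {K : Type*} [Field K] {α : PowerSeries K} (h : α.order = 2)
    (P : Polynomial K) (hP : P ≠ 0) :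
    ∃ i Q, P = Polynomial.X ^ i * Q ∧ Q.coeff 0 ≠ 0 ∧
      (Polynomial.aeval α P).order = (2 * i : ℕ) := by
  obtain ⟨Q, hQ, hd⟩ := Polynomial.exists_eq_pow_rootMultiplicity_mul_and_not_dvd P hP 0
  simp only [map_zero, sub_zero] at hQ hd
  rw [Polynomial.X_dvd_iff] at hd
  refine ⟨_, Q, hQ, hd, ?_⟩
  have hc : PowerSeries.constantCoeff α = 0 := by
    apply PowerSeries.order_ne_zero_iff_constCoeff_eq_zero.mp
    rw [h]; decide
  have hu : (Polynomial.aeval α Q).order = 0 := by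
    apply aux_unit_order
    have : PowerSeries.constantCoeff (Polynomial.aeval α Q) = Q.coeff 0 := by
      rw [Polynomial.aeval_def, Polynomial.hom_eval₂, hc]
      rw [Polynomial.eval₂_at_zero]
      simp
    rwa [this]
  conv_lhs => rw [hQ]
  rw [map_mul, map_pow, Polynomial.aeval_X, PowerSeries.order_mul, hu,
    aux_order_pow (e := 2) (by simpa using h), add_zero, mul_comm]

theorem aux_order_aeval_dvd {K : Type*} [Field K] {α : PowerSeries K} (h : α.order = 2)
    (P : Polynomial K) (k : ℕ) :
    ((2 * k : ℕ) : ℕ∞) ≤ (Polynomial.aeval α P).order ↔ Polynomial.X ^ k ∣ P := by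
  constructor
  · intro hk
    by_cases hP : P = 0
    · simp [hP]
    obtain ⟨i, Q, hPQ, -, ho⟩ := aux_order_aeval h P hP
    rw [ho] at hk
    have : 2 * k ≤ 2 * i := by exact_mod_cast hk
    rw [hPQ]
    exact Dvd.dvd.mul_right (pow_dvd_pow _ (by omega)) _
  · rintro ⟨Q, rfl⟩
    rw [map_mul, map_pow, Polynomial.aeval_X, PowerSeries.order_mul,
      aux_order_pow (e := 2) (by simpa using h), mul_comm]
    exact le_self_add

theorem aux_order_aeval_not_odd {K : Type*} [Field K] {α : PowerSeries K} (h : α.order = 2)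
    (P : Polynomial K) (k : ℕ) :
    (Polynomial.aeval α P).order ≠ (2 * k + 1 : ℕ) := by
  by_cases hP : P = 0
  · rw [hP, map_zero, PowerSeries.order_zero]; exact (ENat.natCast_ne_top _).symm
  obtain ⟨i, Q, hPQ, -, ho⟩ := aux_order_aeval h P hP
  rw [ho]
  intro h
  have : 2 * i = 2 * k + 1 := by exact_mod_cast h
  omega

theorem aux_sub_order {K : Type*} [Field K] {f g : PowerSeries K} {N : ℕ}
    (hf : f.order = N) (hg : g.order = N) : ∃ c : K, ((N + 1 : ℕ) : ℕ∞) ≤ (f - c • g).order := by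
  have hg' := (PowerSeries.order_eq_nat.mp hg)
  have hf' := (PowerSeries.order_eq_nat.mp hf)
  refine ⟨PowerSeries.coeff N f / PowerSeries.coeff N g, ?_⟩
  apply PowerSeries.nat_le_order
  intro i hi
  rcases Nat.lt_succ_iff_lt_or_eq.mp hi with h | h
  · simp [hf'.2 i h, hg'.2 i h]
  · subst h; simp [hg'.1]

theorem aux_reduce {K A : Type*} [Field K] [CommRing A] [Algebra K A] (φ : A →ₐ[K] PowerSeries K)
    (ω : A) (hω : (φ ω).order = 2) (h : A) (N : ℕ) :
    ∃ P : Polynomial K, (N : ℕ∞) ≤ (φ (h - Polynomial.aeval ω P)).order ∨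
      ∃ k, 2 * k + 1 < N ∧ (φ (h - Polynomial.aeval ω P)).order = (2 * k + 1 : ℕ) := by
  induction N with
  | zero => exact ⟨0, Or.inl (by simp)⟩
  | succ N ih =>
    obtain ⟨P, hP | ⟨k, hk, hP⟩⟩ := ih
    · rcases hP.lt_or_eq with hlt | heq
      · exact ⟨P, Or.inl (by rw [Nat.cast_succ]; exact Order.add_one_le_of_lt hlt)⟩
      · rcases Nat.even_or_odd' N with ⟨k, rfl | rfl⟩
        · obtain ⟨c, hc⟩ := aux_sub_order heq.symm (g := (φ ω) ^ k) (by
            rw [aux_order_pow (e := 2) (by simpa using hω), mul_comm])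
          refine ⟨P + c • Polynomial.X ^ k, Or.inl ?_⟩
          have : φ (h - Polynomial.aeval ω (P + c • Polynomial.X ^ k)) =
            φ (h - Polynomial.aeval ω P) - c • φ ω ^ k := by
            simp [sub_sub]
          rwa [this]
        · exact ⟨P, Or.inr ⟨k, by omega, heq.symm⟩⟩
    · exact ⟨P, Or.inr ⟨k, by omega, hP⟩⟩

/-- curvilinear criterion for quotients -/
theorem aux_curv {K A : Type*} [Field K] [CommRing A] [Algebra K A] (φ : A →ₐ[K] PowerSeries K)
    (ω : A) (hω : (φ ω).order = 2) (t : ℕ) (Q : Ideal A)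
    (hQ : ∀ h, h ∈ Q ↔ ((2 * t : ℕ) : ℕ∞) ≤ (φ h).order) :
    Nonempty ((A ⧸ Q) ≃ₐ[K] (Polynomial K ⧸ Ideal.span {(Polynomial.X : Polynomial K) ^ t})) ↔
      ∀ h : A, ∀ k < t, (φ h).order ≠ (2 * k + 1 : ℕ) := by
  have hev : ∀ P : Polynomial K, φ (Polynomial.aeval ω P) = Polynomial.aeval (φ ω) P := fun P => by
    rw [Polynomial.aeval_algHom_apply]
  constructor
  · rintro ⟨e⟩ h k hk ho
    have hmon : ((Polynomial.X : Polynomial K) ^ t).Monic := Polynomial.monic_X_pow t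
    have hfin : Module.finrank K (A ⧸ Q) = t := by
      rw [e.toLinearEquiv.finrank_eq, finrank_quotient_span_eq_natDegree]
      simp
    have : Module.Finite K (Polynomial K ⧸ Ideal.span {(Polynomial.X : Polynomial K) ^ t}) :=
      hmon.finite_quotient
    have : Module.Finite K (A ⧸ Q) := Module.Finite.equiv e.toLinearEquiv.symm
    let T : (Polynomial.degreeLT K t × K) →ₗ[K] (A ⧸ Q) :=
      LinearMap.coprod
        ((Ideal.Quotient.mkₐ K Q).toLinearMap ∘ₗ (Polynomial.aeval ω).toLinearMap ∘ₗ
          (Polynomial.degreeLT K t).subtype)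
        (LinearMap.toSpanSingleton K (A ⧸ Q) (Ideal.Quotient.mkₐ K Q h))
    have hT : Function.Injective T := by
      rw [← LinearMap.ker_eq_bot, LinearMap.ker_eq_bot']
      rintro ⟨⟨P, hP⟩, d⟩ hz
      have hz' : Polynomial.aeval ω P + d • h ∈ Q := by
        rw [← Ideal.Quotient.eq_zero_iff_mem]
        have e1 : Ideal.Quotient.mk Q (d • h) = d • Ideal.Quotient.mk Q h :=
          map_smul (Ideal.Quotient.mkₐ K Q) d h
        rw [map_add, e1]
        simpa [T] using hz
      rw [hQ, map_add, map_smul, hev] at hz'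
      have hd : d = 0 := by
        by_contra hd
        have hoh : (d • φ h).order = (2 * k + 1 : ℕ) := by
          rw [PowerSeries.smul_eq_C_mul, PowerSeries.order_mul, ho, aux_unit_order (by simpa using hd)]
          simp
        rw [PowerSeries.order_add_of_order_ne _ _
          (by rw [hoh]; exact aux_order_aeval_not_odd hω P k), hoh] at hz'
        have := hz'.trans inf_le_right
        have : 2 * t ≤ 2 * k + 1 := by exact_mod_cast this
        omega
      subst hd
      rw [zero_smul, add_zero, aux_order_aeval_dvd hω] at hz'
      have hP0 : P = 0 := by
        by_contra hP0
        rw [Polynomial.mem_degreeLT] at hP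
        have := Polynomial.degree_le_of_dvd hz' hP0
        rw [Polynomial.degree_X_pow] at this
        exact absurd (lt_of_le_of_lt this hP) (lt_irrefl _)
      simp [hP0]
    have := LinearMap.finrank_le_finrank_of_injective hT
    rw [Module.finrank_prod, hfin, (Polynomial.degreeLTEquiv K t).finrank_eq] at this
    simp at this
  · intro hno
    let Ψ : Polynomial K →ₐ[K] (A ⧸ Q) := (Ideal.Quotient.mkₐ K Q).comp (Polynomial.aeval ω)
    have hsurj : Function.Surjective Ψ := by
      intro x
      obtain ⟨h, rfl⟩ := Ideal.Quotient.mk_surjective x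
      obtain ⟨P, hP | ⟨k, hk, hP⟩⟩ := aux_reduce φ ω hω h (2 * t)
      · refine ⟨P, ?_⟩
        rw [← hQ] at hP
        exact ((Ideal.Quotient.mk_eq_mk_iff_sub_mem _ _).mpr hP).symm
      · exact absurd hP (hno _ k (by omega))
    have hker : RingHom.ker Ψ = Ideal.span {(Polynomial.X : Polynomial K) ^ t} := by
      ext P
      rw [RingHom.mem_ker, Ideal.mem_span_singleton, ← aux_order_aeval_dvd hω, ← hev, ← hQ,
        ← Ideal.Quotient.eq_zero_iff_mem]
      rfl
    exact ⟨((Ideal.quotientEquivAlgOfEq K hker).symm.trans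
      (Ideal.quotientKerAlgEquivOfSurjective hsurj)).symm⟩

/-! ### Power series in two variables -/

section
variable {K : Type*} [Field K]

/-- power series from a coefficient function -/
noncomputable def psOf (c : ℕ → ℕ → K) : MvPowerSeries (Fin 2) K := fun n => c (n 0) (n 1)

theorem coeff_psOf (c : ℕ → ℕ → K) (n : Fin 2 →₀ ℕ) :
    MvPowerSeries.coeff n (psOf c) = c (n 0) (n 1) := rfl

/-- coefficient function -/
noncomputable def cf (b : MvPowerSeries (Fin 2) K) (i j : ℕ) : K :=
  MvPowerSeries.coeff (Finsupp.single 0 i + Finsupp.single 1 j) b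

theorem fin2_eta (n : Fin 2 →₀ ℕ) : Finsupp.single 0 (n 0) + Finsupp.single 1 (n 1) = n := by
  ext i; fin_cases i <;> simp

theorem coeff_eq_cf (b : MvPowerSeries (Fin 2) K) (n : Fin 2 →₀ ℕ) :
    MvPowerSeries.coeff n b = cf b (n 0) (n 1) := by
  rw [cf, fin2_eta]

theorem ps_ext {b b' : MvPowerSeries (Fin 2) K} (h : ∀ i j, cf b i j = cf b' i j) : b = b' := by
  ext n; rw [coeff_eq_cf, coeff_eq_cf, h]

theorem cf_psOf (c : ℕ → ℕ → K) (i j : ℕ) : cf (psOf c) i j = c i j := by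
  simp [cf, coeff_psOf]

theorem cf_add (b b' : MvPowerSeries (Fin 2) K) (i j : ℕ) :
    cf (b + b') i j = cf b i j + cf b' i j := by simp [cf]

theorem cf_sub (b b' : MvPowerSeries (Fin 2) K) (i j : ℕ) :
    cf (b - b') i j = cf b i j - cf b' i j := by simp [cf]

theorem cf_X0 (b : MvPowerSeries (Fin 2) K) (s i j : ℕ) :
    cf (MvPowerSeries.X 0 ^ s * b) i j = if s ≤ i then cf b (i - s) j else 0 := by
  have hle : (Finsupp.single (0 : Fin 2) s ≤ Finsupp.single 0 i + Finsupp.single 1 j) ↔ s ≤ i := by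
    rw [Finsupp.single_le_iff]; simp
  rw [cf, MvPowerSeries.X_pow_eq, MvPowerSeries.coeff_monomial_mul]
  simp only [hle, one_mul]
  split_ifs with h
  · rw [coeff_eq_cf]; simp
  · rfl

theorem cf_X1 (b : MvPowerSeries (Fin 2) K) (s i j : ℕ) :
    cf (MvPowerSeries.X 1 ^ s * b) i j = if s ≤ j then cf b i (j - s) else 0 := by
  have hle : (Finsupp.single (1 : Fin 2) s ≤ Finsupp.single 0 i + Finsupp.single 1 j) ↔ s ≤ j := by
    rw [Finsupp.single_le_iff]; simp
  rw [cf, MvPowerSeries.X_pow_eq, MvPowerSeries.coeff_monomial_mul]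
  simp only [hle, one_mul]
  split_ifs with h
  · rw [coeff_eq_cf]; simp
  · rfl

theorem cf_zero (b : MvPowerSeries (Fin 2) K) : cf b 0 0 = MvPowerSeries.constantCoeff b := by
  simp [cf]

theorem ps_split (b : MvPowerSeries (Fin 2) K) (hb : MvPowerSeries.constantCoeff b = 0) :
    ∃ b1 b2, b = MvPowerSeries.X 0 * b1 + MvPowerSeries.X 1 * b2 := by
  refine ⟨psOf fun i j => cf b (i + 1) j, psOf fun i j => if i = 0 then cf b 0 (j + 1) else 0, ?_⟩
  apply ps_ext
  intro i j
  have h0 := cf_X0 (psOf fun i j => cf b (i + 1) j) 1 i j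
  have h1 := cf_X1 (psOf fun i j => if i = 0 then cf b 0 (j + 1) else 0) 1 i j
  rw [pow_one] at h0 h1
  rw [cf_add, h0, h1, cf_psOf, cf_psOf]
  rw [← cf_zero] at hb
  rcases i with _ | i
  · rcases j with _ | j
    · simpa using hb
    · simp
  · simp

theorem ps_expand (b : MvPowerSeries (Fin 2) K) (N : ℕ) :
    ∃ (P : Polynomial K) (b1 b2 : MvPowerSeries (Fin 2) K),
      b = Polynomial.eval₂ MvPowerSeries.C (MvPowerSeries.X 0) P
        + MvPowerSeries.X 1 * b1 + MvPowerSeries.X 0 ^ N * b2 := by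
  induction N generalizing b with
  | zero => exact ⟨0, 0, b, by simp⟩
  | succ N ih =>
    obtain ⟨b1, b2, h⟩ := ps_split (b - MvPowerSeries.C (MvPowerSeries.constantCoeff b)) (by simp)
    obtain ⟨P, c1, c2, h'⟩ := ih b1
    refine ⟨Polynomial.C (MvPowerSeries.constantCoeff b) + Polynomial.X * P,
      b2 + MvPowerSeries.X 0 * c1, c2, ?_⟩
    rw [sub_eq_iff_eq_add] at h
    conv_lhs => rw [h, h']
    simp only [Polynomial.eval₂_add, Polynomial.eval₂_C, Polynomial.eval₂_mul, Polynomial.eval₂_X]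
    ring

/-- recursion for the quotient -/
noncomputable def qrec (s : ℕ) (c : ℕ → ℕ → K) (i j : ℕ) : K :=
  c i (j + 2) + if h : s + 1 ≤ i then qrec s c (i - (s + 1)) (j + 2) else 0
termination_by i

theorem ps_div (b : MvPowerSeries (Fin 2) K) (s : ℕ) :
    ∃ (q : MvPowerSeries (Fin 2) K) (g h : ℕ → K),
      b = q * (MvPowerSeries.X 1 ^ 2 - MvPowerSeries.X 0 ^ (s + 1)) +
        psOf (fun i j => if j = 0 then g i else 0) +
        MvPowerSeries.X 1 * psOf (fun i j => if j = 0 then h i else 0) := by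
  obtain ⟨q, hq⟩ : ∃ q : MvPowerSeries (Fin 2) K, ∀ i j,
      cf q i j = cf b i (j + 2) + if s + 1 ≤ i then cf q (i - (s + 1)) (j + 2) else 0 := by
    refine ⟨psOf (qrec s (cf b)), fun i j => ?_⟩
    simp only [cf_psOf]
    conv_lhs => rw [qrec]
    split_ifs <;> rfl
  refine ⟨q, fun i => cf b i 0 + if s + 1 ≤ i then cf q (i - (s + 1)) 0 else 0,
    fun i => cf b i 1 + if s + 1 ≤ i then cf q (i - (s + 1)) 1 else 0, ?_⟩
  apply ps_ext
  intro i j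
  rw [mul_sub, mul_comm q, mul_comm q, cf_add, cf_add, cf_sub, cf_X0, cf_X1, cf_psOf]
  have h1 := cf_X1 (psOf (fun i j => if j = 0 then
    (cf b i 1 + if s + 1 ≤ i then cf q (i - (s + 1)) 1 else 0) else 0)) 1 i j
  rw [pow_one, cf_psOf] at h1
  rw [h1]
  rcases j with _ | _ | j
  · simp
  · simp
  · simp [hq i j]

theorem ps_uonly (g : ℕ → K) (hg : g ≠ 0) : ∃ (i : ℕ) (u : MvPowerSeries (Fin 2) K), IsUnit u ∧
    psOf (fun i j => if j = 0 then g i else 0) = MvPowerSeries.X 0 ^ i * u := by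
  classical
  have hex : ∃ i, g i ≠ 0 := by
    by_contra h; push Not at h; exact hg (funext h)
  refine ⟨Nat.find hex, psOf fun i j => if j = 0 then g (i + Nat.find hex) else 0, ?_, ?_⟩
  · rw [MvPowerSeries.isUnit_iff_constantCoeff, ← cf_zero, cf_psOf]
    simpa using Nat.find_spec hex
  · apply ps_ext
    intro i j
    rw [cf_X0, cf_psOf, cf_psOf]
    by_cases hj : j = 0
    · simp only [hj, if_true]
      split_ifs with h
      · rw [Nat.sub_add_cancel h]
      · have := Nat.find_min hex (not_le.mp h)
        simpa using this
    · simp [hj]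

/-- injectivity modulo the relation -/
theorem ps_ker (m : ℕ) (θ : MvPowerSeries (Fin 2) K →+* PowerSeries K)
    (hα : (θ (MvPowerSeries.X 0)).order = 2)
    (hr : θ (MvPowerSeries.X 1) ^ 2 = θ (MvPowerSeries.X 0) ^ (2 * m + 1))
    (b : MvPowerSeries (Fin 2) K) (hb : θ b = 0) :
    b ∈ Ideal.span {(MvPowerSeries.X 1 : MvPowerSeries (Fin 2) K) ^ 2
      - MvPowerSeries.X 0 ^ (2 * m + 1)} := by
  have hβ : (θ (MvPowerSeries.X 1)).order = (2 * m + 1 : ℕ) := by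
    have h1 := congrArg PowerSeries.order hr
    have h2 := aux_order_pow (α := θ (MvPowerSeries.X 0)) (e := 2) (by simpa using hα) (2 * m + 1)
    rw [h2, PowerSeries.order_pow] at h1
    have hne : (θ (MvPowerSeries.X 1)).order ≠ ⊤ := by
      intro h; rw [h] at h1
      have h3 : (2 : ℕ) • (⊤ : ℕ∞) = ⊤ := by simp
      rw [h3] at h1
      exact ENat.natCast_ne_top _ h1.symm
    lift (θ (MvPowerSeries.X 1)).order to ℕ using hne with x
    have : 2 * x = (2 * m + 1) * 2 := by
      rw [nsmul_eq_mul] at h1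
      exact_mod_cast h1
    congr 1; omega
  obtain ⟨q, g, h, rfl⟩ := ps_div b (2 * m)
  have hord : ∀ g : ℕ → K, g ≠ 0 →
      ∃ i : ℕ, (θ (psOf (fun i j => if j = 0 then g i else 0))).order = (2 * i : ℕ) := by
    intro g hg
    obtain ⟨i, u, hu, he⟩ := ps_uonly g hg
    refine ⟨i, ?_⟩
    rw [he, map_mul, map_pow, PowerSeries.order_mul, PowerSeries.order_zero_of_unit (hu.map θ),
      aux_order_pow (e := 2) (by simpa using hα), add_zero, mul_comm]
  have hpz : psOf (fun i j => if j = 0 then (0 : ℕ → K) i else 0) = 0 := by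
    apply ps_ext; intro i j; rw [cf_psOf]; simp [cf]
  simp only [map_add, map_mul, map_sub, map_pow, hr, sub_self, mul_zero, zero_add] at hb
  have hh : h = 0 := by
    by_contra hh
    obtain ⟨i, hi⟩ := hord h hh
    by_cases hg : g = 0
    · rw [hg, hpz, map_zero, zero_add] at hb
      have := congrArg PowerSeries.order hb
      rw [PowerSeries.order_mul, hi, hβ, PowerSeries.order_zero] at this
      exact ENat.natCast_ne_top (2 * m + 1 + 2 * i) (by exact_mod_cast this)
    · obtain ⟨j, hj⟩ := hord g hg
      rw [add_eq_zero_iff_eq_neg] at hb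
      have := congrArg PowerSeries.order hb
      rw [PowerSeries.order_neg, PowerSeries.order_mul, hi, hβ, hj] at this
      have : 2 * j = (2 * m + 1) + 2 * i := by exact_mod_cast this
      omega
  subst hh
  rw [hpz, map_zero, mul_zero, add_zero] at hb
  have hg : g = 0 := by
    by_contra hg
    obtain ⟨j, hj⟩ := hord g hg
    rw [hb, PowerSeries.order_zero] at hj
    exact ENat.natCast_ne_top _ hj.symm
  subst hg
  rw [hpz, mul_zero, add_zero, add_zero]
  exact Ideal.mul_mem_left _ _ (Ideal.subset_span rfl)
end

/-! ### Local rings and completions -/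

section
variable {K O : Type*} [Field K] [CommRing O] (M : Ideal O)

theorem ac_complete (hM : M.FG) : IsAdicComplete (M.map (algebraMap O (AdicCompletion M O)))
    (AdicCompletion M O) := by
  have := AdicCompletion.isAdicComplete (M := O) hM
  exact (IsAdicComplete.map_algebraMap_iff (S := AdicCompletion M O) M _).mpr this

theorem ac_approx (hM : M.FG) (x : AdicCompletion M O) (N : ℕ) : ∃ o : O,
    x - algebraMap _ _ o ∈ (M.map (algebraMap O (AdicCompletion M O))) ^ N := by
  obtain ⟨o, ho⟩ := Submodule.Quotient.mk_surjective _ (AdicCompletion.eval M O N x)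
  refine ⟨o, ?_⟩
  have h1 : x - algebraMap _ (AdicCompletion M O) o ∈
      (AdicCompletion.eval M O N).ker := by
    rw [LinearMap.mem_ker]
    have : AdicCompletion.eval M O N
      (algebraMap _ (AdicCompletion M O) o) = Submodule.Quotient.mk o := rfl
    rw [map_sub, this, ho, sub_self]
  rw [← AdicCompletion.pow_smul_top_eq_ker_eval hM] at h1
  rw [Ideal.smul_top_eq_map] at h1
  rw [← Ideal.map_pow]
  exact h1

theorem ac_lift (ψ : O →+* PowerSeries K)
    (hm : ∀ h ∈ M, PowerSeries.X ∣ ψ h) :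
    ∃ φ' : AdicCompletion M O →+* PowerSeries K, ∀ o, φ' (algebraMap _ _ o) = ψ o := by
  set X' : Ideal (PowerSeries K) := Ideal.span {PowerSeries.X} with hX
  have hle : ∀ n, M ^ n ≤ (X' ^ n).comap ψ := by
    intro n
    rw [← Ideal.map_le_iff_le_comap, Ideal.map_pow]
    apply Ideal.pow_right_mono
    rw [Ideal.map_le_iff_le_comap]
    intro h hh
    rw [Ideal.mem_comap, hX, Ideal.mem_span_singleton]
    exact hm h hh
  let f : ∀ n, AdicCompletion M O →+* PowerSeries K ⧸ X' ^ n := fun n =>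
    (Ideal.quotientMap (X' ^ n) ψ (hle n)).comp
      (AdicCompletion.evalₐ M n : AdicCompletion M O →+* _)
  have hf : ∀ {m n : ℕ} (hmn : m ≤ n), (Ideal.Quotient.factorPow X' hmn).comp (f n) = f m := by
    intro m n hmn
    ext x
    obtain ⟨y, rfl⟩ := AdicCompletion.mk_surjective M O x
    simp only [f, RingHom.comp_apply, RingHom.coe_coe, AdicCompletion.evalₐ_mk]
    simp only [Ideal.quotientMap_mk]
    change Ideal.Quotient.mk _ _ = _
    rw [Ideal.Quotient.eq, ← map_sub]
    apply hle
    have := y.property hmn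
    rw [SModEq.sub_mem] at this
    rw [← neg_sub, neg_mem_iff]
    simpa using this
  refine ⟨IsAdicComplete.liftRingHom X' f hf, fun o => ?_⟩
  rw [← sub_eq_zero]
  apply IsHausdorff.haus (inferInstance : IsHausdorff X' (PowerSeries K))
  intro n
  rw [SModEq.zero, smul_eq_mul, Ideal.mul_top, ← Ideal.Quotient.eq_zero_iff_mem, map_sub,
    IsAdicComplete.mk_liftRingHom, sub_eq_zero]
  change Ideal.quotientMap (X' ^ n) ψ (hle n) (AdicCompletion.evalₐ M n
    (algebraMap _ (AdicCompletion M O) o)) = _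
  rw [AlgHom.commutes]
  rfl
end

section
variable {K : Type*} [Field K] (I : Ideal (MvPolynomial (Fin 2) K)) (a : Fin 2 → K)

instance lrTower : IsScalarTower K (MvPolynomial (Fin 2) K) (LocalRingAt I a) :=
  inferInstanceAs (IsScalarTower K (MvPolynomial (Fin 2) K) (Localization _))

theorem lr_unit {s : MvPolynomial (Fin 2) K} (hs : eval a s ≠ 0) :
    IsUnit (algebraMap (MvPolynomial (Fin 2) K) (LocalRingAt I a) s) := by
  have : Ideal.Quotient.mk I s ∈ ((RingHom.ker (MvPolynomial.eval a :
      MvPolynomial (Fin 2) K →+* K)).primeCompl).map (Ideal.Quotient.mk I) :=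
    ⟨s, by simpa [Ideal.primeCompl, RingHom.mem_ker] using hs, rfl⟩
  exact IsLocalization.map_units (Localization _) ⟨_, this⟩

theorem lr_surj (o : LocalRingAt I a) : ∃ h s : MvPolynomial (Fin 2) K, eval a s ≠ 0 ∧
    o * algebraMap _ _ s = algebraMap _ _ h := by
  obtain ⟨⟨x, ⟨y, s, hs, rfl⟩⟩, hxy⟩ := IsLocalization.surj (((RingHom.ker (MvPolynomial.eval a :
      MvPolynomial (Fin 2) K →+* K)).primeCompl).map (Ideal.Quotient.mk I)) (S := Localization _) o
  obtain ⟨h, rfl⟩ := Ideal.Quotient.mk_surjective x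
  exact ⟨h, s, by simpa [Ideal.primeCompl, RingHom.mem_ker] using hs, hxy⟩

theorem lr_zero {h : MvPolynomial (Fin 2) K} (hh : h ∈ I) :
    algebraMap (MvPolynomial (Fin 2) K) (LocalRingAt I a) h = 0 := by
  have h1 : algebraMap (MvPolynomial (Fin 2) K) (LocalRingAt I a) h =
    algebraMap _ (Localization (((RingHom.ker (MvPolynomial.eval a :
      MvPolynomial (Fin 2) K →+* K)).primeCompl).map (Ideal.Quotient.mk I)))
      (Ideal.Quotient.mk I h) := rfl
  rw [h1, Ideal.Quotient.eq_zero_iff_mem.mpr hh, map_zero]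
  rfl

theorem lr_lift {R : Type*} [CommRing R] (φ : MvPolynomial (Fin 2) K →+* R)
    (hI : ∀ h ∈ I, φ h = 0) (hu : ∀ s, eval a s ≠ 0 → IsUnit (φ s)) :
    ∃ ψ : LocalRingAt I a →+* R, ∀ h, ψ (algebraMap _ _ h) = φ h := by
  have hy : ∀ y : (((RingHom.ker (MvPolynomial.eval a :
      MvPolynomial (Fin 2) K →+* K)).primeCompl).map (Ideal.Quotient.mk I)),
      IsUnit (Ideal.Quotient.lift I φ hI y) := by
    rintro ⟨_, s, hs, rfl⟩
    exact hu s (by simpa [Ideal.primeCompl, RingHom.mem_ker] using hs)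
  refine ⟨IsLocalization.lift (S := Localization (((RingHom.ker (MvPolynomial.eval a :
      MvPolynomial (Fin 2) K →+* K)).primeCompl).map (Ideal.Quotient.mk I))) hy, fun h => ?_⟩
  exact IsLocalization.lift_eq (S := Localization _) hy (Ideal.Quotient.mk I h)

/-- The local ring is the quotient itself when everything outside the maximal ideal is a unit. -/
theorem lr_equiv (hu : ∀ s, eval a s ≠ 0 → IsUnit (Ideal.Quotient.mk I s)) :
    Nonempty (LocalRingAt I a ≃ₐ[K] (MvPolynomial (Fin 2) K ⧸ I)) := by
  have hy : ∀ x ∈ (((RingHom.ker (MvPolynomial.eval a :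
      MvPolynomial (Fin 2) K →+* K)).primeCompl).map (Ideal.Quotient.mk I)), IsUnit x := by
    rintro _ ⟨s, hs, rfl⟩
    exact hu s (by simpa [Ideal.primeCompl, RingHom.mem_ker] using hs)
  let e := IsLocalization.atUnits (MvPolynomial (Fin 2) K ⧸ I) (S := Localization (((RingHom.ker
      (MvPolynomial.eval a : MvPolynomial (Fin 2) K →+* K)).primeCompl).map
      (Ideal.Quotient.mk I))) _ hy
  exact ⟨(e.restrictScalars K).symm⟩

/-- the extended maximal ideal -/
noncomputable abbrev mxI : Ideal (LocalRingAt I a) :=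
  ((RingHom.ker (MvPolynomial.eval a : MvPolynomial (Fin 2) K →+* K)).map
      (algebraMap (MvPolynomial (Fin 2) K) (LocalRingAt I a)))

theorem mxI_fg : (mxI I a).FG :=
  Ideal.FG.map (IsNoetherian.noetherian _) _

theorem lc_complete : IsAdicComplete ((mxI I a).map (algebraMap _ (LocalCompletion I a)))
    (LocalCompletion I a) := ac_complete (mxI I a) (mxI_fg I a)

theorem lc_approx (x : LocalCompletion I a) (N : ℕ) : ∃ o : LocalRingAt I a,
    x - algebraMap _ _ o ∈ ((mxI I a).map (algebraMap _ (LocalCompletion I a))) ^ N :=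
  ac_approx (mxI I a) (mxI_fg I a) x N

theorem lc_lift (ψ : LocalRingAt I a →+* PowerSeries K)
    (hm : ∀ h, eval a h = 0 → PowerSeries.X ∣ ψ (algebraMap _ _ h)) :
    ∃ φ' : LocalCompletion I a →+* PowerSeries K, ∀ o, φ' (algebraMap _ _ o) = ψ o := by
  apply ac_lift (mxI I a) ψ
  have : mxI I a ≤ (Ideal.span {PowerSeries.X}).comap ψ := by
    rw [Ideal.map_le_iff_le_comap]
    intro h hh
    rw [Ideal.mem_comap, Ideal.mem_comap, Ideal.mem_span_singleton]
    exact hm h hh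
  intro h hh
  exact Ideal.mem_span_singleton.mp (this hh)
end

section
variable {K : Type*} [Field K] (I : Ideal (MvPolynomial (Fin 2) K)) (a : Fin 2 → K)

theorem ps_cc_dvd {f : PowerSeries K} (h : PowerSeries.constantCoeff f = 0) : PowerSeries.X ∣ f :=
  PowerSeries.X_dvd_iff.mpr h

theorem lc_main (φ : MvPolynomial (Fin 2) K →ₐ[K] PowerSeries K)
    (hI : ∀ h ∈ I, φ h = 0) (hcc : ∀ h, PowerSeries.constantCoeff (φ h) = eval a h) :
    ∃ φ' : LocalCompletion I a →+* PowerSeries K,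
      (∀ h : MvPolynomial (Fin 2) K, φ' (algebraMap (LocalRingAt I a) _ (algebraMap _ _ h)) = φ h) ∧
      ∀ x (N : ℕ), ∃ h s, eval a s ≠ 0 ∧ PowerSeries.X ^ N ∣ φ' x * φ s - φ h := by
  obtain ⟨ψ, hψ⟩ := lr_lift I a (φ : MvPolynomial (Fin 2) K →+* PowerSeries K) hI (fun s hs => by
    rw [PowerSeries.isUnit_iff_constantCoeff]
    simpa [hcc] using hs)
  obtain ⟨φ', hφ'⟩ := lc_lift I a ψ (fun h hh => by
    rw [hψ]; apply ps_cc_dvd; simpa [hcc] using hh)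
  have hA : ∀ h : MvPolynomial (Fin 2) K,
      φ' (algebraMap (LocalRingAt I a) _ (algebraMap _ _ h)) = φ h := fun h => by
    rw [hφ', hψ]; rfl
  refine ⟨φ', hA, fun x N => ?_⟩
  obtain ⟨o, ho⟩ := lc_approx I a x N
  obtain ⟨h, s, hs, hsh⟩ := lr_surj I a o
  refine ⟨h, s, hs, ?_⟩
  have h1 : ((mxI I a).map (algebraMap _ (LocalCompletion I a))) ^ N ≤
      (Ideal.span {(PowerSeries.X : PowerSeries K) ^ N}).comap φ' := by
    rw [← Ideal.map_le_iff_le_comap, Ideal.map_pow, ← Ideal.span_singleton_pow]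
    apply Ideal.pow_right_mono
    rw [Ideal.map_map, Ideal.map_map, Ideal.map_le_iff_le_comap]
    intro h hh
    rw [Ideal.mem_comap, Ideal.mem_span_singleton]
    change _ ∣ φ' (algebraMap (LocalRingAt I a) _ (algebraMap _ _ h))
    rw [hA]
    apply ps_cc_dvd
    rw [hcc]; exact hh
  have h2 := Ideal.mem_span_singleton.mp (h1 ho)
  have h3 : φ' x * φ s - φ h = φ' (x - algebraMap _ _ o) * φ s := by
    rw [map_sub, sub_mul, hφ' o, ← hA s, ← hA h, ← hsh, hφ', hφ', map_mul]
  rw [h3]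
  exact Dvd.dvd.mul_right h2 _

theorem order_ge_iff {f : PowerSeries K} {N : ℕ} : (N : ℕ∞) ≤ f.order ↔ PowerSeries.X ^ N ∣ f := by
  rw [PowerSeries.X_pow_dvd_iff]
  constructor
  · intro h i hi
    exact PowerSeries.coeff_of_lt_order i (lt_of_lt_of_le (by exact_mod_cast hi) h)
  · intro h; exact PowerSeries.nat_le_order f N h

/-- If `f - g` vanishes to order `> N`, then `f` has order `N` iff `g` does. -/
theorem order_congr {f g : PowerSeries K} {N : ℕ} (h : PowerSeries.X ^ (N + 1) ∣ f - g)
    (hf : f.order = N) : g.order = N := by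
  rw [PowerSeries.X_pow_dvd_iff] at h
  rw [PowerSeries.order_eq_nat] at hf ⊢
  have h' : ∀ i < N + 1, PowerSeries.coeff i f = PowerSeries.coeff i g := fun i hi => by
    have := h i hi
    rwa [map_sub, sub_eq_zero] at this
  exact ⟨by rw [← h' N (by omega)]; exact hf.1, fun i hi => by rw [← h' i (by omega)]; exact hf.2 i hi⟩

theorem fwd_local (m : ℕ) (hm : 1 ≤ m) (φ : MvPolynomial (Fin 2) K →ₐ[K] PowerSeries K)
    (hI : ∀ h ∈ I, φ h = 0) (hcc : ∀ h, PowerSeries.constantCoeff (φ h) = eval a h)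
    (e : LocalCompletion I a ≃+* (MvPowerSeries (Fin 2) K ⧸ Ideal.span
          {(MvPowerSeries.X 1 : MvPowerSeries (Fin 2) K) ^ 2 - MvPowerSeries.X 0 ^ (2 * m + 1)}))
    (he : ∀ r : K, e (algebraMap (LocalRingAt I a) (LocalCompletion I a) (algebraMap K _ r))
          = algebraMap K _ r) :
    (∀ h, eval a h = 0 → (2 : ℕ∞) ≤ (φ h).order) ∧
    ((∃ h, (φ h).order = 2) → (∀ h, ∀ k < m, (φ h).order ≠ (2 * k + 1 : ℕ)) ∧
      ∃ h, (φ h).order = (2 * m + 1 : ℕ)) := by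
  obtain ⟨φ', hA, happ⟩ := lc_main I a φ hI hcc
  set θ : MvPowerSeries (Fin 2) K →+* PowerSeries K :=
    (φ'.comp e.symm.toRingHom).comp (Ideal.Quotient.mk _) with hθ
  have hθC : ∀ r, θ (MvPowerSeries.C r) = PowerSeries.C r := by
    intro r
    have h1 : Ideal.Quotient.mk (Ideal.span
          {(MvPowerSeries.X 1 : MvPowerSeries (Fin 2) K) ^ 2 - MvPowerSeries.X 0 ^ (2 * m + 1)})
          (MvPowerSeries.C r) = algebraMap K _ r := rfl
    simp only [hθ, RingHom.comp_apply, h1, RingEquiv.toRingHom_eq_coe, RingHom.coe_coe]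
    rw [← he, RingEquiv.symm_apply_apply,
      IsScalarTower.algebraMap_apply K (MvPolynomial (Fin 2) K) (LocalRingAt I a), hA,
      AlgHom.commutes]
    rfl
  have hlift : ∀ h, ∃ b, θ b = φ h := by
    intro h
    obtain ⟨b, hb⟩ := Ideal.Quotient.mk_surjective
      (e (algebraMap (LocalRingAt I a) _ (algebraMap _ _ h)))
    refine ⟨b, ?_⟩
    simp only [hθ, RingHom.comp_apply, hb, RingEquiv.toRingHom_eq_coe, RingHom.coe_coe, RingEquiv.symm_apply_apply, hA]
  have hrel : θ (MvPowerSeries.X 1) ^ 2 = θ (MvPowerSeries.X 0) ^ (2 * m + 1) := by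
    rw [← sub_eq_zero, ← map_pow, ← map_pow, ← map_sub, hθ, RingHom.comp_apply,
      Ideal.Quotient.eq_zero_iff_mem.mpr (Ideal.mem_span_singleton_self _), map_zero]
  have hunit : ∀ b, PowerSeries.constantCoeff (θ b) = 0 → MvPowerSeries.constantCoeff b = 0 := by
    intro b hb
    by_contra hne
    have : IsUnit b := by
      rw [MvPowerSeries.isUnit_iff_constantCoeff]; exact isUnit_iff_ne_zero.mpr hne
    have h2 := this.map θ
    rw [PowerSeries.isUnit_iff_constantCoeff, hb] at h2
    exact not_isUnit_zero h2
  set α := θ (MvPowerSeries.X 0) with hα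
  set β := θ (MvPowerSeries.X 1) with hβ
  have hα0 : PowerSeries.constantCoeff α = 0 := by
    have := hunit (MvPowerSeries.X 0 - MvPowerSeries.C (PowerSeries.constantCoeff α))
      (by rw [map_sub, hθC, map_sub]; simp [hα])
    simpa using this
  have hαX : (1 : ℕ∞) ≤ α.order := by
    have := (order_ge_iff (f := α) (N := 1)).mpr (by simpa using ps_cc_dvd hα0)
    simpa using this
  have hord := congrArg PowerSeries.order hrel
  rw [PowerSeries.order_pow, PowerSeries.order_pow, nsmul_eq_mul, nsmul_eq_mul] at hord
  have hab : 2 ≤ α.order ∧ 3 ≤ β.order := by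
    by_cases hat : α.order = ⊤
    · rw [hat] at hord
      have hbt : β.order = ⊤ := by
        by_contra hb
        lift β.order to ℕ using hb with y
        rw [ENat.mul_top (by simp)] at hord
        exact ENat.natCast_ne_top (2 * y) (by exact_mod_cast hord)
      simp [hat, hbt]
    · have hbt : β.order ≠ ⊤ := by
        intro hb
        rw [hb, ENat.mul_top (by simp)] at hord
        lift α.order to ℕ using hat with y
        exact ENat.natCast_ne_top ((2 * m + 1) * y) (by exact_mod_cast hord.symm)
      lift α.order to ℕ using hat with x
      lift β.order to ℕ using hbt with y
      norm_cast at hord hαX ⊢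
      have hx2 : 2 ≤ x := by
        rcases Nat.lt_or_ge x 2 with h | h
        · have : x = 1 := by omega
          subst this; omega
        · exact h
      refine ⟨hx2, ?_⟩
      nlinarith
  have hXa : PowerSeries.X ^ 2 ∣ α := order_ge_iff.mp (by simpa using hab.1)
  have hXb : PowerSeries.X ^ 3 ∣ β := order_ge_iff.mp (by simpa using hab.2)
  have key : ∀ h, eval a h = 0 → ∃ b1 b2, φ h = α * b1 + β * b2 := by
    intro h hh
    obtain ⟨b, hb⟩ := hlift h
    obtain ⟨b1, b2, hbb⟩ := ps_split b (hunit b (by rw [hb, hcc, hh]))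
    exact ⟨θ b1, θ b2, by rw [← hb, hbb]; simp [hα, hβ]⟩
  refine ⟨?_, ?_⟩
  · intro h hh
    obtain ⟨b1, b2, hb⟩ := key h hh
    have : ((2 : ℕ) : ℕ∞) ≤ (φ h).order := by
      rw [order_ge_iff, hb]
      exact dvd_add (hXa.mul_right _) (((pow_dvd_pow _ (by norm_num)).trans hXb).mul_right _)
    simpa using this
  · rintro ⟨h0, hh0⟩
    have hα2 : α.order = 2 := by
      refine le_antisymm ?_ hab.1
      by_contra hlt
      rw [not_le] at hlt
      have h3 : (3 : ℕ∞) ≤ α.order := by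
        have := Order.add_one_le_of_lt hlt
        norm_num at this
        exact this
      have hXa3 : PowerSeries.X ^ 3 ∣ α := order_ge_iff.mp (by simpa using h3)
      have h0a : eval a h0 = 0 := by
        rw [← hcc]
        by_contra hne
        rw [aux_unit_order hne] at hh0
        simp at hh0
      obtain ⟨b1, b2, hb⟩ := key h0 h0a
      have : ((3 : ℕ) : ℕ∞) ≤ (φ h0).order := by
        rw [order_ge_iff, hb]
        exact dvd_add (hXa3.mul_right _) (hXb.mul_right _)
      rw [hh0] at this
      norm_cast at this
    have hβ2 : β.order = (2 * m + 1 : ℕ) := by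
      rw [hα2] at hord
      have hne : β.order ≠ ⊤ := by
        intro hb
        rw [hb, ENat.mul_top (by simp)] at hord
        exact ENat.natCast_ne_top ((2 * m + 1) * 2) (by exact_mod_cast hord.symm)
      lift β.order to ℕ using hne with y
      norm_cast at hord ⊢
      omega
    have hαm : PowerSeries.X ^ (2 * m) ∣ α ^ m := by
      rw [pow_mul]; exact pow_dvd_pow_of_dvd hXa m
    have hβm : PowerSeries.X ^ (2 * m) ∣ β := by
      rw [← order_ge_iff, hβ2]; exact_mod_cast (by omega)
    refine ⟨?_, ?_⟩
    · intro h k hk hodd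
      obtain ⟨b, hb⟩ := hlift h
      obtain ⟨P, b1, b2, hbb⟩ := ps_expand b m
      have h1 : θ (Polynomial.eval₂ MvPowerSeries.C (MvPowerSeries.X 0) P) =
          Polynomial.aeval α P := by
        rw [Polynomial.hom_eval₂, Polynomial.aeval_def]
        congr 1
        ext r : 1
        exact hθC r
      have h2 : PowerSeries.X ^ (2 * m) ∣ φ h - Polynomial.aeval α P := by
        rw [← hb, hbb, map_add, map_add, h1, map_mul, map_mul, map_pow]
        have : Polynomial.aeval α P + β * θ b1 + α ^ m * θ b2 - Polynomial.aeval α P =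
          β * θ b1 + α ^ m * θ b2 := by ring
        rw [this]
        exact dvd_add (hβm.mul_right _) (hαm.mul_right _)
      exact aux_order_aeval_not_odd hα2 P k
        (order_congr ((pow_dvd_pow _ (by omega)).trans h2) hodd)
    · obtain ⟨h, s, hs, hd⟩ := happ (e.symm (Ideal.Quotient.mk _ (MvPowerSeries.X 1))) (2 * m + 2)
      refine ⟨h, order_congr hd ?_⟩
      change (β * φ s).order = _
      rw [PowerSeries.order_mul, aux_unit_order (f := φ s) (by rwa [hcc]), hβ2, add_zero]
end

section
variable {K : Type*} [Field K]

theorem ps_hom {R : Type*} [CommRing R] (κ : K →+* R) (J : Ideal R) [IsAdicComplete J R]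
    (U : Fin 2 → R) (hU : ∀ i, U i ∈ J) :
    ∃ Θ : MvPowerSeries (Fin 2) K →+* R, (∀ i, Θ (MvPowerSeries.X i) = U i) ∧
      ∀ r, Θ (MvPowerSeries.C r) = κ r := by
  set η : MvPolynomial (Fin 2) K →+* R := eval₂Hom κ U with hη
  have hle : ∀ n, (idealOfVars (Fin 2) K) ^ n ≤ (J ^ n).comap η := by
    intro n
    rw [← Ideal.map_le_iff_le_comap, Ideal.map_pow]
    apply Ideal.pow_right_mono
    rw [Ideal.map_le_iff_le_comap, idealOfVars, Ideal.span_le]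
    rintro _ ⟨i, rfl⟩
    simpa [hη] using hU i
  let f : ∀ n, MvPowerSeries (Fin 2) K →+* R ⧸ J ^ n := fun n =>
    (Ideal.quotientMap (J ^ n) η (hle n)).comp
      (MvPowerSeries.truncTotalAlgHom (Fin 2) K n : MvPowerSeries (Fin 2) K →+* _)
  have hf : ∀ {m n : ℕ} (hmn : m ≤ n), (Ideal.Quotient.factorPow J hmn).comp (f n) = f m := by
    intro m n hmn
    ext x
    simp only [f, RingHom.comp_apply, RingHom.coe_coe, MvPowerSeries.truncTotalAlgHom_apply]
    simp only [Ideal.quotientMap_mk]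
    change Ideal.Quotient.mk _ _ = _
    rw [Ideal.Quotient.eq, ← map_sub]
    apply hle
    exact MvPowerSeries.truncTotal_sub_truncTotal_mem_pow_idealOfVars hmn le_rfl x
  have key : ∀ q : MvPolynomial (Fin 2) K, IsAdicComplete.liftRingHom J f hf q = η q := by
    intro q
    rw [← sub_eq_zero]
    apply IsHausdorff.haus (inferInstance : IsHausdorff J R)
    intro n
    rw [SModEq.zero, smul_eq_mul, Ideal.mul_top, ← Ideal.Quotient.eq_zero_iff_mem, map_sub,
      IsAdicComplete.mk_liftRingHom, sub_eq_zero]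
    change Ideal.quotientMap (J ^ n) η (hle n) (MvPowerSeries.truncTotalAlgHom (Fin 2) K n
      (algebraMap (MvPolynomial (Fin 2) K) _ q)) = _
    rw [AlgHom.commutes]
    rfl
  refine ⟨IsAdicComplete.liftRingHom J f hf, fun i => ?_, fun r => ?_⟩
  · rw [← MvPolynomial.coe_X, key]; simp [hη]
  · rw [← MvPolynomial.coe_C, key]; simp [hη]

theorem ps_hom_surj {R : Type*} [CommRing R] (κ : K →+* R) (J : Ideal R) [IsAdicComplete J R]
    (U : Fin 2 → R) (hJ : J = Ideal.span (Set.range U)) (hκ : ∀ r : R, ∃ k, r - κ k ∈ J)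
    (Θ : MvPowerSeries (Fin 2) K →+* R) (hX : ∀ i, Θ (MvPowerSeries.X i) = U i)
    (hC : ∀ r, Θ (MvPowerSeries.C r) = κ r) : Function.Surjective Θ := by
  have hmap : (Ideal.span (Set.range (MvPowerSeries.X : Fin 2 → MvPowerSeries (Fin 2) K))).map Θ
      = J := by
    rw [Ideal.map_span, hJ, ← Set.range_comp]
    congr 2; ext i; exact hX i
  have : IsHausdorff ((Ideal.span (Set.range
      (MvPowerSeries.X : Fin 2 → MvPowerSeries (Fin 2) K))).map Θ) R := by
    rw [hmap]; infer_instance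
  apply surjective_of_mk_map_comp_surjective Θ
    (I := Ideal.span (Set.range (MvPowerSeries.X : Fin 2 → MvPowerSeries (Fin 2) K)))
  intro r
  obtain ⟨r, rfl⟩ := Ideal.Quotient.mk_surjective r
  obtain ⟨k, hk⟩ := hκ r
  refine ⟨MvPowerSeries.C k, ?_⟩
  rw [RingHom.comp_apply, hC, eq_comm, Ideal.Quotient.eq, hmap]
  exact hk

theorem dec_lemma {A : Type*} [CommRing A] [Algebra K A] (ω y : A)
    (h : Algebra.adjoin K {ω, y} = ⊤) (x : A) :
    ∃ (A0 A1 : Polynomial K) (A2 : A),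
      x = Polynomial.aeval ω A0 + Polynomial.aeval ω A1 * y + y ^ 2 * A2 := by
  have hx : x ∈ Algebra.adjoin K {ω, y} := by rw [h]; trivial
  induction hx using Algebra.adjoin_induction with
  | mem x hx =>
    rcases hx with rfl | rfl
    · exact ⟨Polynomial.X, 0, 0, by simp⟩
    · exact ⟨0, 1, 0, by simp⟩
  | algebraMap r => exact ⟨Polynomial.C r, 0, 0, by simp⟩
  | add x z _ _ h1 h2 =>
    obtain ⟨A0, A1, A2, rfl⟩ := h1
    obtain ⟨B0, B1, B2, rfl⟩ := h2
    exact ⟨A0 + B0, A1 + B1, A2 + B2, by simp only [map_add]; ring⟩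
  | mul x z _ _ h1 h2 =>
    obtain ⟨A0, A1, A2, rfl⟩ := h1
    obtain ⟨B0, B1, B2, rfl⟩ := h2
    exact ⟨A0 * B0, A0 * B1 + A1 * B0, Polynomial.aeval ω A1 * Polynomial.aeval ω B1 +
      A2 * (Polynomial.aeval ω B0 + Polynomial.aeval ω B1 * y + y ^ 2 * B2) +
      (Polynomial.aeval ω A0 + Polynomial.aeval ω A1 * y) * B2, by
        simp only [map_add, map_mul]; ring⟩

/-- Final step: relation `V² = U^(2m+1)` in a complete ring gives the isomorphism. -/
theorem rev_iso {R : Type*} [CommRing R] (κ : K →+* R) (J : Ideal R) [IsAdicComplete J R]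
    (U V : R) (hJ : J = Ideal.span {U, V}) (hκ : ∀ r : R, ∃ k, r - κ k ∈ J) (m : ℕ)
    (hV : V ^ 2 = U ^ (2 * m + 1)) (φ : R →+* PowerSeries K) (hφ : (φ U).order = 2) :
    ∃ e : R ≃+* (MvPowerSeries (Fin 2) K ⧸ Ideal.span
          {(MvPowerSeries.X 1 : MvPowerSeries (Fin 2) K) ^ 2 - MvPowerSeries.X 0 ^ (2 * m + 1)}),
      ∀ r : K, e (κ r) = algebraMap K _ r := by
  have hr : Set.range ![U, V] = {U, V} := by simp [Matrix.range_cons, Set.pair_comm]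
  obtain ⟨Θ, hX, hC⟩ := ps_hom κ J ![U, V] (fun i => by
    rw [hJ, ← hr]; exact Ideal.subset_span ⟨i, rfl⟩)
  have hs := ps_hom_surj κ J ![U, V] (by rw [hJ, hr]) hκ Θ hX hC
  have h0 : Θ (MvPowerSeries.X 0) = U := by simpa using hX 0
  have h1 : Θ (MvPowerSeries.X 1) = V := by simpa using hX 1
  have hker : RingHom.ker Θ = Ideal.span
          {(MvPowerSeries.X 1 : MvPowerSeries (Fin 2) K) ^ 2 - MvPowerSeries.X 0 ^ (2 * m + 1)} := by
    apply le_antisymm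
    · intro b hb
      apply ps_ker m (φ.comp Θ)
      · simpa [h0] using hφ
      · simp only [RingHom.comp_apply, h0, h1, ← map_pow, hV]
      · rw [RingHom.comp_apply, RingHom.mem_ker.mp hb, map_zero]
    · rw [Ideal.span_le, Set.singleton_subset_iff, SetLike.mem_coe, RingHom.mem_ker]
      simp [h0, h1, hV]
  let e := (Ideal.quotEquivOfEq hker).symm.trans (RingHom.quotientKerEquivOfSurjective hs)
  refine ⟨e.symm, fun r => ?_⟩
  rw [RingEquiv.symm_apply_eq, ← hC]
  rfl
end

section
variable {K : Type*} [Field K]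

theorem sqrt_complete [IsAlgClosed K] [CharZero K] {R : Type*} [CommRing R] (κ : K →+* R)
    (J : Ideal R) [IsAdicComplete J R]
    (W : R) (w : K) (hw : w ≠ 0) (hW : W - κ w ∈ J) : ∃ z : R, z ^ 2 = W := by
  obtain ⟨w0, hw0⟩ := IsAlgClosed.exists_pow_nat_eq w (n := 2) (by norm_num)
  have h0 : w0 ≠ 0 := by rintro rfl; exact hw (by simpa using hw0.symm)
  obtain ⟨z, hz, -⟩ := HenselianRing.is_henselian (I := J) (Polynomial.X ^ 2 - Polynomial.C W)
    (Polynomial.monic_X_pow_sub_C W (by norm_num)) (κ w0) (by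
      simp only [Polynomial.eval_sub, Polynomial.eval_pow, Polynomial.eval_X, Polynomial.eval_C]
      rw [← map_pow, hw0, ← neg_sub, neg_mem_iff]; exact hW) (by
      apply IsUnit.map
      simp only [Polynomial.derivative_sub, Polynomial.derivative_X_pow, Polynomial.derivative_C,
        sub_zero, Polynomial.eval_mul, Polynomial.eval_C, Polynomial.eval_pow, Polynomial.eval_X]
      have : IsUnit (κ (2 * w0)) := (isUnit_iff_ne_zero.mpr (by simp [h0])).map κ
      rw [map_mul, map_ofNat] at this
      simpa using this)
  refine ⟨z, ?_⟩
  simpa [Polynomial.IsRoot, sub_eq_zero] using hz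

theorem rev_local [IsAlgClosed K] [CharZero K] (m : ℕ) (hm : 1 ≤ m)
    (a : Fin 2 → K) (g : MvPolynomial (Fin 2) K)
    (φ : MvPolynomial (Fin 2) K →ₐ[K] PowerSeries K)
    (hg : φ g = 0) (hcc : ∀ h, PowerSeries.constantCoeff (φ h) = eval a h)
    (hg3 : g ∉ (RingHom.ker (eval a : MvPolynomial (Fin 2) K →+* K)) ^ 3)
    (ω y0 : MvPolynomial (Fin 2) K) (hadj : Algebra.adjoin K {ω, y0} = ⊤)
    (hω : (φ ω).order = 2)
    (hodd : ∀ h, ∀ k < m, (φ h).order ≠ (2 * k + 1 : ℕ))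
    (hex : ∃ h, (φ h).order = (2 * m + 1 : ℕ)) :
    ∃ e : LocalCompletion (Ideal.span {g}) a ≃+* (MvPowerSeries (Fin 2) K ⧸ Ideal.span
          {(MvPowerSeries.X 1 : MvPowerSeries (Fin 2) K) ^ 2 - MvPowerSeries.X 0 ^ (2 * m + 1)}),
      ∀ r : K, e (algebraMap (LocalRingAt (Ideal.span {g}) a) (LocalCompletion (Ideal.span {g}) a)
        (algebraMap K _ r)) = algebraMap K _ r := by
  have hev : ∀ P : Polynomial K, φ (Polynomial.aeval ω P) = Polynomial.aeval (φ ω) P := fun P => by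
    rw [Polynomial.aeval_algHom_apply]
  have hωa : eval a ω = 0 := by
    rw [← hcc]
    by_contra hne
    rw [aux_unit_order hne] at hω
    simp at hω
  have heva : ∀ P : Polynomial K, eval a (Polynomial.aeval ω P) = P.coeff 0 := by
    intro P
    induction P using Polynomial.induction_on' with
    | add p q hp hq => simp [hp, hq]
    | monomial n r =>
      rw [Polynomial.aeval_monomial, map_mul, map_pow, hωa]
      rcases n with _ | n
      · simp
      · simp [Polynomial.coeff_monomial]
  -- choice of y
  obtain ⟨P, hP⟩ := aux_reduce φ ω hω y0 (2 * m + 2)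
  set y := y0 - Polynomial.aeval ω P with hy
  have hadj' : Algebra.adjoin K {ω, y} = ⊤ := by
    rw [eq_top_iff, ← hadj]
    apply Algebra.adjoin_le
    have h1 : ω ∈ Algebra.adjoin K {ω, y} := Algebra.subset_adjoin (by simp)
    have h2 : y ∈ Algebra.adjoin K {ω, y} := Algebra.subset_adjoin (by simp)
    rintro _ (rfl | rfl)
    · exact h1
    · have : _ = y + Polynomial.aeval ω P := (sub_add_cancel _ _).symm
      rw [this]
      exact add_mem h2 (Polynomial.aeval_mem_adjoin_singleton K ω |> fun h =>
        Algebra.adjoin_mono (by simp) h)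
  have hyord : (φ y).order = (2 * m + 1 : ℕ) := by
    rcases hP with hP | ⟨k, hk, hP⟩
    · exfalso
      obtain ⟨h, hh⟩ := hex
      obtain ⟨A0, A1, A2, hd⟩ := dec_lemma ω y hadj' h
      have h1 : PowerSeries.X ^ (2 * m + 2) ∣ φ h - Polynomial.aeval (φ ω) A0 := by
        have h2 : φ h - Polynomial.aeval (φ ω) A0 =
            φ y * (φ (Polynomial.aeval ω A1) + φ y * φ A2) := by
          rw [hd]; simp only [map_add, map_mul, map_pow, hev]; ring
        rw [h2]
        exact (order_ge_iff.mp hP).mul_right _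
      exact aux_order_aeval_not_odd hω A0 m (order_congr h1 hh)
    · rcases Nat.lt_or_ge k m with hlt | hge
      · exact absurd hP (hodd _ k hlt)
      · have : k = m := by omega
        rw [← this]; exact hP
  have hya : eval a y = 0 := by
    rw [← hcc]
    by_contra hne
    rw [aux_unit_order hne] at hyord
    have : 0 = 2 * m + 1 := by exact_mod_cast hyord
    omega
  set 𝔪 := RingHom.ker (eval a : MvPolynomial (Fin 2) K →+* K) with h𝔪
  have hω𝔪 : ω ∈ 𝔪 := hωa
  have hy𝔪 : y ∈ 𝔪 := hya
  have h𝔪span : 𝔪 = Ideal.span {ω, y} := by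
    apply le_antisymm
    · intro h hh
      obtain ⟨A0, A1, A2, hd⟩ := dec_lemma ω y hadj' h
      have h0 : A0.coeff 0 = 0 := by
        have : eval a h = 0 := hh
        rw [hd] at this
        simpa [heva, hya] using this
      obtain ⟨B, rfl⟩ := Polynomial.X_dvd_iff.mpr h0
      rw [hd]
      refine Ideal.mem_span_pair.mpr ⟨Polynomial.aeval ω B, Polynomial.aeval ω A1 + y * A2, ?_⟩
      simp only [map_mul, Polynomial.aeval_X]; ring
    · rw [Ideal.span_le]
      rintro _ (rfl | rfl)
      · exact hω𝔪
      · exact hy𝔪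
  -- decompose g
  obtain ⟨A0, A1, A2, hd⟩ := dec_lemma ω y hadj' g
  set γ := φ y with hγ
  set α := φ ω with hα
  have hrel : Polynomial.aeval α A0 + Polynomial.aeval α A1 * γ = - (γ ^ 2 * φ A2) := by
    have := hg
    rw [hd] at this
    simp only [map_add, map_mul, map_pow, hev] at this
    linear_combination this
  have hγ2 : (γ ^ 2).order = (4 * m + 2 : ℕ) := by
    rw [aux_order_pow hyord]; congr 1; ring
  have hsum : ((4 * m + 2 : ℕ) : ℕ∞) ≤
      (Polynomial.aeval α A0 + Polynomial.aeval α A1 * γ).order := by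
    rw [hrel, PowerSeries.order_neg, PowerSeries.order_mul, hγ2]
    exact le_self_add
  have hne : Polynomial.aeval α A0 = 0 ∨ (Polynomial.aeval α A0).order ≠
      (Polynomial.aeval α A1 * γ).order := by
    by_cases h0 : A0 = 0
    · left; simp [h0]
    right
    obtain ⟨i, -, -, -, hi⟩ := aux_order_aeval hω A0 h0
    rw [PowerSeries.order_mul, hi, hyord]
    by_cases h1 : A1 = 0
    · simp [h1]; exact_mod_cast ENat.natCast_ne_top (2 * i)
    · obtain ⟨j, -, -, -, hj⟩ := aux_order_aeval hω A1 h1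
      rw [hj]
      norm_cast
      omega
  have hmin : ((4 * m + 2 : ℕ) : ℕ∞) ≤ (Polynomial.aeval α A0).order ∧
      ((4 * m + 2 : ℕ) : ℕ∞) ≤ (Polynomial.aeval α A1 * γ).order := by
    rcases hne with h0 | hne
    · rw [h0, zero_add] at hsum
      exact ⟨by rw [h0, PowerSeries.order_zero]; exact le_top, hsum⟩
    · rw [PowerSeries.order_add_of_order_ne _ _ hne] at hsum
      exact le_inf_iff.mp hsum
  have hA0 : Polynomial.X ^ (2 * m + 1) ∣ A0 := by
    rw [← aux_order_aeval_dvd hω]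
    convert hmin.1 using 2; ring
  have hA1 : Polynomial.X ^ (m + 1) ∣ A1 := by
    by_cases h1 : A1 = 0
    · simp [h1]
    rw [← aux_order_aeval_dvd hω]
    obtain ⟨j, -, -, -, hj⟩ := aux_order_aeval hω A1 h1
    have := hmin.2
    rw [PowerSeries.order_mul, hj, hyord] at this
    rw [hj]
    norm_cast at this ⊢
    omega
  obtain ⟨B0, rfl⟩ := hA0
  obtain ⟨B1, rfl⟩ := hA1
  simp only [map_mul, map_pow, Polynomial.aeval_X] at hd hrel
  have hA2 : eval a A2 ≠ 0 := by
    intro h0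
    apply hg3
    have h0' : A2 ∈ 𝔪 := h0
    have e1 : ω ^ 3 ∈ 𝔪 ^ 3 := Ideal.pow_mem_pow hω𝔪 3
    have e2 : ω ^ 2 * y ∈ 𝔪 ^ 3 := by
      rw [pow_succ 𝔪 2]; exact Ideal.mul_mem_mul (Ideal.pow_mem_pow hω𝔪 2) hy𝔪
    have e3 : y ^ 2 * A2 ∈ 𝔪 ^ 3 := by
      rw [pow_succ 𝔪 2]; exact Ideal.mul_mem_mul (Ideal.pow_mem_pow hy𝔪 2) h0'
    obtain ⟨k, rfl⟩ : ∃ k, m = k + 1 := ⟨m - 1, by omega⟩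
    have : g = (ω ^ (2 * k) * Polynomial.aeval ω B0) * ω ^ 3 +
      (ω ^ k * Polynomial.aeval ω B1) * (ω ^ 2 * y) + y ^ 2 * A2 := by
      rw [hd]; ring
    rw [this]
    exact add_mem (add_mem (Ideal.mul_mem_left _ _ e1) (Ideal.mul_mem_left _ _ e2)) e3
  have hB0 : B0.coeff 0 ≠ 0 := by
    have h1 : PowerSeries.X ^ (4 * m + 2 + 1) ∣
        -(γ ^ 2 * φ A2) - α ^ (2 * m + 1) * Polynomial.aeval α B0 := by
      rw [← hrel, add_sub_cancel_left]
      have e1 : PowerSeries.X ^ (2 * (m + 1)) ∣ α ^ (m + 1) := by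
        rw [pow_mul]
        exact pow_dvd_pow_of_dvd (order_ge_iff.mp (by rw [hω]; rfl)) _
      have e2 : PowerSeries.X ^ (2 * m + 1) ∣ γ := order_ge_iff.mp hyord.ge
      have e3 := mul_dvd_mul (e1.mul_right (Polynomial.aeval α B1)) e2
      rw [← pow_add] at e3
      convert e3 using 2; ring
    have h2 : (-(γ ^ 2 * φ A2)).order = (4 * m + 2 : ℕ) := by
      rw [PowerSeries.order_neg, PowerSeries.order_mul, hγ2, aux_unit_order (f := φ A2)
        (by rwa [hcc]), add_zero]
    have h3 := order_congr h1 h2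
    intro h0
    obtain ⟨B, rfl⟩ := Polynomial.X_dvd_iff.mpr h0
    have h4 : ((2 * (2 * m + 2) : ℕ) : ℕ∞) ≤
        (Polynomial.aeval α (Polynomial.X ^ (2 * m + 1) * (Polynomial.X * B))).order := by
      rw [aux_order_aeval_dvd hω]
      exact ⟨B, by ring⟩
    rw [map_mul, map_pow, Polynomial.aeval_X, h3] at h4
    norm_cast at h4
    omega
  -- pass to the completion
  set I := Ideal.span {g} with hI
  obtain ⟨φ', hA, -⟩ := lc_main I a φ (fun h hh => by
    obtain ⟨c, rfl⟩ := Ideal.mem_span_singleton.mp hh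
    rw [map_mul, hg, zero_mul]) hcc
  set ι : MvPolynomial (Fin 2) K →+* LocalCompletion I a :=
    (algebraMap (LocalRingAt I a) _).comp (algebraMap _ _) with hι
  set κ : K →+* LocalCompletion I a := ι.comp C with hκ
  set J := (mxI I a).map (algebraMap _ (LocalCompletion I a)) with hJ
  have hJc : IsAdicComplete J (LocalCompletion I a) := lc_complete I a
  have hJm : J = 𝔪.map ι := by rw [hJ, mxI, Ideal.map_map]
  have hιg : ι g = 0 := by
    rw [hι, RingHom.comp_apply, lr_zero I a (Ideal.mem_span_singleton_self g), map_zero]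
  have hιu : ∀ s, eval a s ≠ 0 → IsUnit (ι s) := fun s hs => by
    rw [hι, RingHom.comp_apply]; exact (lr_unit I a hs).map _
  have hιm : ∀ s, ι s - κ (eval a s) ∈ J := by
    intro s
    have hκ' : κ (eval a s) = ι (C (eval a s)) := rfl
    rw [hκ', ← map_sub, hJm]
    apply Ideal.mem_map_of_mem
    rw [h𝔪, RingHom.mem_ker]
    simp
  have hκs : ∀ r : LocalCompletion I a, ∃ k, r - κ k ∈ J := by
    intro r
    obtain ⟨o, ho⟩ := lc_approx I a r 1
    rw [pow_one] at ho
    obtain ⟨h, s, hs, hsh⟩ := lr_surj I a o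
    refine ⟨eval a h / eval a s, ?_⟩
    obtain ⟨u, hu⟩ := hιu s hs
    have h1 : (algebraMap _ (LocalCompletion I a) o) * ι s = ι h := by
      rw [hι, RingHom.comp_apply, RingHom.comp_apply, ← map_mul, hsh]
    have h2 : (r - κ (eval a h / eval a s)) * ι s ∈ J := by
      have h3 : (r - κ (eval a h / eval a s)) * ι s =
          (r - algebraMap _ (LocalCompletion I a) o) * ι s + (ι h - κ (eval a h)) -
          κ (eval a h / eval a s) * (ι s - κ (eval a s)) := by
        have h4 : κ (eval a h / eval a s) * κ (eval a s) = κ (eval a h) := by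
          rw [← map_mul, div_mul_cancel₀ _ hs]
        linear_combination -h4 + h1
      rw [h3]
      exact sub_mem (add_mem (Ideal.mul_mem_right _ _ ho) (hιm h)) (Ideal.mul_mem_left _ _ (hιm s))
    rw [← hu] at h2
    have := Ideal.mul_mem_right (↑u⁻¹ : LocalCompletion I a) J h2
    rwa [mul_assoc, Units.mul_inv, mul_one] at this
  -- the square root
  set W : MvPolynomial (Fin 2) K := ω * Polynomial.aeval ω B1 ^ 2 - 4 * A2 * Polynomial.aeval ω B0
    with hW
  have hWa : eval a W ≠ 0 := by
    have : eval a W = - (4 * eval a A2 * B0.coeff 0) := by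
      rw [hW]; simp [heva, hωa]
    rw [this, neg_ne_zero]
    exact mul_ne_zero (mul_ne_zero (by norm_num) hA2) hB0
  obtain ⟨z, hz⟩ := sqrt_complete κ J (ι W) _ hWa (hιm W)
  have hzu : IsUnit z := by
    have := hιu W hWa
    rw [← hz] at this
    exact (isUnit_pow_iff (by norm_num)).mp this
  obtain ⟨u, rfl⟩ := hzu
  obtain ⟨v, hv⟩ := hιu A2 hA2
  have h2u : IsUnit (2 : LocalCompletion I a) := by
    have := hιu (2 : MvPolynomial (Fin 2) K) (by rw [map_ofNat]; norm_num)
    rw [map_ofNat] at this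
    exact this
  obtain ⟨q, hq⟩ := h2u
  set T := ι (2 * A2 * y + ω ^ (m + 1) * Polynomial.aeval ω B1) with hT
  have hT2 : T ^ 2 = ι ω ^ (2 * m + 1) * (u : LocalCompletion I a) ^ 2 := by
    rw [hz, hT, ← map_pow, ← map_pow, ← map_mul, ← sub_eq_zero, ← map_sub]
    have : (2 * A2 * y + ω ^ (m + 1) * Polynomial.aeval ω B1) ^ 2 - ω ^ (2 * m + 1) * W
      = 4 * A2 * g := by
      rw [hd, hW]; ring
    rw [this, map_mul, hιg, mul_zero]
  set V := (↑u⁻¹ : LocalCompletion I a) * T with hV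
  have huu : (↑u⁻¹ : LocalCompletion I a) * u = 1 := Units.inv_mul u
  have hV2 : V ^ 2 = ι ω ^ (2 * m + 1) := by
    rw [hV, mul_pow, hT2]
    have : ((↑u⁻¹ : LocalCompletion I a) * u) ^ 2 = 1 := by rw [huu, one_pow]
    linear_combination ι ω ^ (2 * m + 1) * this
  have hJV : J = Ideal.span {ι ω, V} := by
    rw [hJm, h𝔪span, Ideal.map_span, Set.image_pair]
    have hTe : T = 2 * ι A2 * ι y + ι ω ^ (m + 1) * ι (Polynomial.aeval ω B1) := by
      rw [hT]; simp only [map_add, map_mul, map_pow, map_ofNat]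
    apply le_antisymm
    · rw [Ideal.span_le]
      rintro _ (rfl | rfl)
      · exact Ideal.subset_span (by simp)
      · refine Ideal.mem_span_pair.mpr ⟨-(↑q⁻¹ * ↑v⁻¹ * ι ω ^ m * ι (Polynomial.aeval ω B1)),
          ↑q⁻¹ * ↑v⁻¹ * u, ?_⟩
        have e1 : (↑q⁻¹ : LocalCompletion I a) * 2 = 1 := by rw [← hq]; exact Units.inv_mul q
        have e2 : (↑v⁻¹ : LocalCompletion I a) * ι A2 = 1 := by rw [← hv]; exact Units.inv_mul v
        rw [hV, hTe]
        have e3 : (↑q⁻¹ * ↑v⁻¹ * (2 * ι A2) : LocalCompletion I a) = 1 := by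
          linear_combination (↑v⁻¹ * ι A2) * e1 + e2
        linear_combination (↑q⁻¹ * ↑v⁻¹ * (2 * ι A2 * ι y + ι ω ^ (m + 1) *
          ι (Polynomial.aeval ω B1))) * huu + ι y * e3
    · rw [Ideal.span_le]
      rintro _ (rfl | rfl)
      · exact Ideal.subset_span (by simp)
      · refine Ideal.mem_span_pair.mpr ⟨↑u⁻¹ * (ι ω ^ m * ι (Polynomial.aeval ω B1)),
          ↑u⁻¹ * (2 * ι A2), ?_⟩
        rw [hV, hTe]; ring
  obtain ⟨e, he⟩ := rev_iso κ J (ι ω) V hJV hκs m hV2 φ' (by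
    rw [hι, RingHom.comp_apply, hA]; exact hω)
  refine ⟨e, fun r => ?_⟩
  rw [← he, hκ, RingHom.comp_apply, hι, RingHom.comp_apply,
    IsScalarTower.algebraMap_apply K (MvPolynomial (Fin 2) K) (LocalRingAt I a)]
  rfl
end

/-- substitution of the line `v + τ w` -/
noncomputable def thetaHom {K : Type*} [Field K] (v w : Fin 2 → K) :
    MvPolynomial (Fin 2) K →ₐ[K] PowerSeries K :=
  aeval (fun i => PowerSeries.C (v i) + PowerSeries.C (w i) * PowerSeries.X)

theorem bin_form_expand {K : Type*} [Field K] {d : ℕ} {H : MvPolynomial (Fin 2) K}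
    (hH : H.IsHomogeneous d) :
    ∃ c : ℕ → K, H = ∑ k ∈ Finset.range (d + 1), C (c k) * X 0 ^ (d - k) * X 1 ^ k := by
  refine ⟨fun k => coeff (Finsupp.single 0 (d - k) + Finsupp.single 1 k) H, ?_⟩
  conv_lhs => rw [H.as_sum]
  have key : ∀ μ ∈ H.support, μ = Finsupp.single 0 (d - μ 1) + Finsupp.single 1 (μ 1) ∧ μ 1 ≤ d := by
    intro μ hμ
    have h1 := hH (mem_support_iff.mp hμ)
    rw [Finsupp.weight_apply, Finsupp.sum_fintype _ _ (by simp)] at h1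
    simp [Fin.sum_univ_two] at h1
    refine ⟨?_, by omega⟩
    ext i
    fin_cases i
    · simp; omega
    · simp
  have mon : ∀ k (r : K), C r * X 0 ^ (d - k) * X 1 ^ k =
      monomial (Finsupp.single (0 : Fin 2) (d - k) + Finsupp.single 1 k) r := by
    intro k r
    rw [X_pow_eq_monomial, X_pow_eq_monomial, C_mul_monomial, monomial_mul]; simp
  simp only [mon]
  refine Finset.sum_of_injOn (fun μ => μ 1) ?_ ?_ ?_ ?_
  · intro μ hμ ν hν h
    rw [(key μ hμ).1, (key ν hν).1]
    simp only at h
    rw [h]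
  · intro μ hμ
    simp only [Finset.coe_range, Set.mem_Iio]
    have := (key μ hμ).2
    omega
  · intro k hk hk'
    by_cases h0 : coeff (Finsupp.single 0 (d - k) + Finsupp.single 1 k) H = 0
    · rw [h0, map_zero]
    · exfalso
      apply hk'
      exact ⟨_, mem_support_iff.mpr h0, by simp⟩
  · intro μ hμ
    rw [← (key μ hμ).1]

/-- the form complementary to `linFormOf v` -/
noncomputable def coLin {K : Type*} [Field K] (w : Fin 2 → K) : MvPolynomial (Fin 2) K :=
  C (w 0) * X 1 - C (w 1) * X 0

theorem theta_lin {K : Type*} [Field K] {v w : Fin 2 → K} (hvw : v 1 * w 0 - v 0 * w 1 = 1) :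
    thetaHom v w (linFormOf v) = PowerSeries.X := by
  have h : (PowerSeries.C (v 1 * w 0 - v 0 * w 1) : PowerSeries K) = 1 := by rw [hvw, map_one]
  simp only [map_sub, map_mul] at h
  simp only [thetaHom, linFormOf, map_sub, map_mul, aeval_X, algHom_C, PowerSeries.algebraMap_apply,
    Algebra.algebraMap_self, RingHom.id_apply]
  linear_combination PowerSeries.X * h

theorem theta_colin {K : Type*} [Field K] {v w : Fin 2 → K} (hvw : v 1 * w 0 - v 0 * w 1 = 1) :
    thetaHom v w (coLin w) = 1 := by
  have h : (PowerSeries.C (v 1 * w 0 - v 0 * w 1) : PowerSeries K) = 1 := by rw [hvw, map_one]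
  simp only [map_sub, map_mul] at h
  simp only [thetaHom, coLin, map_sub, map_mul, aeval_X, algHom_C, PowerSeries.algebraMap_apply,
    Algebra.algebraMap_self, RingHom.id_apply]
  linear_combination h

theorem form_expand {K : Type*} [Field K] {v w : Fin 2 → K} (hvw : v 1 * w 0 - v 0 * w 1 = 1)
    {d : ℕ} {H : MvPolynomial (Fin 2) K} (hH : H.IsHomogeneous d) :
    ∃ c : ℕ → K, H = ∑ k ∈ Finset.range (d + 1),
      C (c k) * coLin w ^ (d - k) * linFormOf v ^ k := by
  have h1 : (aeval (fun i => C (v i) * X 0 + C (w i) * X 1 : Fin 2 → MvPolynomial (Fin 2) K)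
      H).IsHomogeneous d := by
    have := hH.aeval (fun i => C (v i) * X 0 + C (w i) * X 1 : Fin 2 → MvPolynomial (Fin 2) K)
      (n := 1) (fun i => ((isHomogeneous_C_mul_X _ _).add (isHomogeneous_C_mul_X _ _)))
    simpa using this
  obtain ⟨c, hc⟩ := bin_form_expand h1
  refine ⟨c, ?_⟩
  have h2 := congrArg (aeval (![coLin w, linFormOf v] : Fin 2 → MvPolynomial (Fin 2) K)) hc
  have h3 : (aeval (![coLin w, linFormOf v] : Fin 2 → MvPolynomial (Fin 2) K))
      (aeval (fun i => C (v i) * X 0 + C (w i) * X 1 : Fin 2 → MvPolynomial (Fin 2) K) H) = H := by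
    rw [← AlgHom.comp_apply]
    conv_rhs => rw [← AlgHom.id_apply (R := K) H]
    congr 1
    apply MvPolynomial.algHom_ext
    have h : (C (v 1 * w 0 - v 0 * w 1) : MvPolynomial (Fin 2) K) = 1 := by rw [hvw, map_one]
    simp only [map_sub, map_mul] at h
    intro i
    fin_cases i
    · simp [coLin, linFormOf]
      linear_combination (X 0) * h
    · simp [coLin, linFormOf]
      linear_combination (X 1) * h
  rw [h3] at h2
  rw [h2]
  simp [map_sum]

theorem theta_dvd_iff {K : Type*} [Field K] {v w : Fin 2 → K} (hvw : v 1 * w 0 - v 0 * w 1 = 1)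
    {d : ℕ} {H : MvPolynomial (Fin 2) K} (hH : H.IsHomogeneous d) (e : ℕ) :
    linFormOf v ^ e ∣ H ↔ (e : ℕ∞) ≤ (thetaHom v w H).order := by
  constructor
  · rintro ⟨q, rfl⟩
    rw [order_ge_iff, map_mul, map_pow, theta_lin hvw]
    exact Dvd.intro _ rfl
  · intro h
    obtain ⟨c, hc⟩ := form_expand hvw hH
    have h1 : thetaHom v w H = ∑ k ∈ Finset.range (d + 1),
        PowerSeries.C (c k) * PowerSeries.X ^ k := by
      conv_lhs => rw [hc]
      simp only [map_sum, map_mul, map_pow, theta_lin hvw, theta_colin hvw, one_pow, mul_one,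
        algHom_C, PowerSeries.algebraMap_apply, Algebra.algebraMap_self, RingHom.id_apply]
    rw [hc]
    apply Finset.dvd_sum
    intro k hk
    by_cases hke : e ≤ k
    · exact (pow_dvd_pow _ hke).mul_left _
    · have h2 : PowerSeries.coeff k (thetaHom v w H) = 0 :=
        PowerSeries.coeff_of_lt_order k (lt_of_lt_of_le (by exact_mod_cast not_le.mp hke) h)
      rw [h1, map_sum] at h2
      simp only [PowerSeries.coeff_C_mul, PowerSeries.coeff_X_pow] at h2
      simp only [mul_ite, mul_one, mul_zero, Finset.sum_ite_eq, hk, if_true] at h2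
      rw [h2]; simp

theorem theta_cc {K : Type*} [Field K] (v w : Fin 2 → K) (H : MvPolynomial (Fin 2) K) :
    PowerSeries.constantCoeff (thetaHom v w H) = eval v H := by
  have : (PowerSeries.constantCoeff (R := K)).comp (thetaHom v w : _ →+* PowerSeries K) = eval v := by
    apply MvPolynomial.ringHom_ext
    · intro r; simp [thetaHom]
    · intro i; simp [thetaHom]
  exact congrArg (fun g => g H) this

theorem exists_dual {K : Type*} [Field K] {v : Fin 2 → K} (hv : v ≠ 0) :
    ∃ w : Fin 2 → K, v 1 * w 0 - v 0 * w 1 = 1 := by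
  by_cases h : v 1 = 0
  · have h0 : v 0 ≠ 0 := by
      intro h0; apply hv; ext i; fin_cases i <;> simp [h, h0]
    exact ⟨![0, -(v 0)⁻¹], by simp [h0]⟩
  · exact ⟨![(v 1)⁻¹, 0], by simp [h]⟩

theorem lin_eq {K : Type*} [Field K] {L : MvPolynomial (Fin 2) K} (hL : L.IsHomogeneous 1)
    (h0 : L ≠ 0) : ∃ v : Fin 2 → K, v ≠ 0 ∧ L = linFormOf v := by
  obtain ⟨c, hc⟩ := bin_form_expand hL
  refine ⟨![-c 1, c 0], ?_, ?_⟩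
  · intro h
    have h1 := congrFun h 0
    have h2 := congrFun h 1
    simp at h1 h2
    apply h0
    rw [hc]; simp [Finset.sum_range_succ, h1, h2]
  · rw [hc]; simp [Finset.sum_range_succ, linFormOf]

theorem hom_scale {K : Type*} [Field K] {R : Type*} [CommRing R] [Algebra K R] {σ : Type*}
    {D : ℕ} {h : MvPolynomial σ K} (hh : h.IsHomogeneous D) (g : σ → R) (r : R) :
    aeval (fun j => r * g j) h = r ^ D * aeval g h := by
  conv_lhs => rw [h.as_sum]
  conv_rhs => rw [h.as_sum]
  rw [map_sum, map_sum, Finset.mul_sum]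
  apply Finset.sum_congr rfl
  intro μ hμ
  have h1 := hh.degree_eq_sum_deg_support hμ
  simp only [aeval_monomial, Finsupp.prod, mul_pow, Finset.prod_mul_distrib]
  rw [Finset.prod_pow_eq_pow_sum, ← h1]
  ring

/-- the local parameterization in the chart `c` -/
noncomputable def phiHom {K : Type*} [Field K] (f : Fin 3 → MvPolynomial (Fin 2) K)
    (v w : Fin 2 → K) (c : Fin 3) : MvPolynomial (Fin 2) K →ₐ[K] PowerSeries K :=
  aeval (fun i => (thetaHom v w (f c))⁻¹ * thetaHom v w (f (chartEmb c i)))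

theorem chart_cases (c j : Fin 3) : j = c ∨ ∃ i, j = chartEmb c i := by
  fin_cases c <;> fin_cases j <;> simp [chartEmb, Fin.exists_fin_two]

theorem dehom_emb {K : Type*} [Field K] (c : Fin 3) (i : Fin 2) :
    (dehomMap c (chartEmb c i) : MvPolynomial (Fin 2) K) = X i := by
  fin_cases c <;> fin_cases i <;> simp [chartEmb, dehomMap]

theorem emb_ne (c : Fin 3) (i : Fin 2) : chartEmb c i ≠ c := by
  fin_cases c <;> fin_cases i <;> simp [chartEmb]

theorem dehom_self {K : Type*} [Field K] (c : Fin 3) :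
    (dehomMap c c : MvPolynomial (Fin 2) K) = 1 := by simp [dehomMap]

theorem phi_dehom {K : Type*} [Field K] (f : Fin 3 → MvPolynomial (Fin 2) K)
    (v w : Fin 2 → K) (c : Fin 3) (hc : eval v (f c) ≠ 0) {D : ℕ} {h : MvPolynomial (Fin 3) K}
    (hh : h.IsHomogeneous D) :
    phiHom f v w c (aeval (dehomMap c) h) =
      (thetaHom v w (f c))⁻¹ ^ D * thetaHom v w (aeval f h) := by
  have h0 : (thetaHom v w (f c))⁻¹ * thetaHom v w (f c) = 1 :=
    PowerSeries.inv_mul_cancel _ (by rwa [theta_cc])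
  have h1 : (phiHom f v w c).comp (aeval (dehomMap c)) =
      aeval (fun j => (thetaHom v w (f c))⁻¹ * thetaHom v w (f j)) := by
    apply MvPolynomial.algHom_ext
    intro j
    rw [AlgHom.comp_apply, aeval_X, aeval_X]
    rcases chart_cases c j with rfl | ⟨i, rfl⟩
    · rw [dehom_self, map_one, h0]
    · rw [dehom_emb, phiHom, aeval_X]
  have h2 : (thetaHom v w).comp (aeval f) = aeval (fun j => thetaHom v w (f j)) := by
    apply MvPolynomial.algHom_ext
    intro j
    simp
  rw [← AlgHom.comp_apply, h1, hom_scale hh, ← h2, AlgHom.comp_apply]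

theorem phi_order {K : Type*} [Field K] (f : Fin 3 → MvPolynomial (Fin 2) K)
    (v w : Fin 2 → K) (c : Fin 3) (hc : eval v (f c) ≠ 0) {D : ℕ} {h : MvPolynomial (Fin 3) K}
    (hh : h.IsHomogeneous D) :
    (phiHom f v w c (aeval (dehomMap c) h)).order = (thetaHom v w (aeval f h)).order := by
  rw [phi_dehom f v w c hc hh, PowerSeries.order_mul, aux_unit_order, zero_add]
  rw [map_pow, PowerSeries.constantCoeff_inv, theta_cc]
  exact pow_ne_zero _ (inv_ne_zero hc)

theorem homogenize {K : Type*} [Field K] (c : Fin 3) (h : MvPolynomial (Fin 2) K) :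
    ∃ D, ∃ H : MvPolynomial (Fin 3) K, H.IsHomogeneous D ∧ aeval (dehomMap c) H = h := by
  induction h using MvPolynomial.induction_on with
  | C r => exact ⟨0, C r, isHomogeneous_C _ _, by simp⟩
  | add p q hp hq =>
    obtain ⟨D, P, hP, rfl⟩ := hp
    obtain ⟨E, Q, hQ, rfl⟩ := hq
    refine ⟨D + E, P * X c ^ E + Q * X c ^ D, ?_, ?_⟩
    · refine (hP.mul (isHomogeneous_X_pow c E)).add ?_
      rw [add_comm]
      exact hQ.mul (isHomogeneous_X_pow c D)
    · simp [dehom_self]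
  | mul_X p i hp =>
    obtain ⟨D, P, hP, rfl⟩ := hp
    exact ⟨D + 1, P * X (chartEmb c i), hP.mul (isHomogeneous_X _ _), by simp [dehom_emb]⟩

theorem phi_cc {K : Type*} [Field K] (f : Fin 3 → MvPolynomial (Fin 2) K)
    (v w : Fin 2 → K) (c : Fin 3) (p : Fin 3 → K) (l : K) (hl : l ≠ 0)
    (hv : ∀ j, eval v (f j) = l * p j) (h : MvPolynomial (Fin 2) K) :
    PowerSeries.constantCoeff (phiHom f v w c h) = eval (affOf p c) h := by
  have : (PowerSeries.constantCoeff (R := K)).comp (phiHom f v w c : _ →+* PowerSeries K)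
      = eval (affOf p c) := by
    apply MvPolynomial.ringHom_ext
    · intro r; simp [phiHom]
    · intro i
      simp only [phiHom, RingHom.comp_apply, RingHom.coe_coe, aeval_X, map_mul,
        PowerSeries.constantCoeff_inv, theta_cc, hv, eval_X, affOf]
      by_cases hpc : p c = 0
      · simp [hpc]
      · field_simp
  exact congrArg (fun g => g h) this

theorem dehom_J_iff {K : Type*} [Field K] {n : ℕ} (f : Fin 3 → MvPolynomial (Fin 2) K)
    (hf : ∀ j, (f j).IsHomogeneous n)
    {v w : Fin 2 → K} (hvw : v 1 * w 0 - v 0 * w 1 = 1) (c : Fin 3) (hc : eval v (f c) ≠ 0)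
    (e : ℕ) (h : MvPolynomial (Fin 2) K) :
    h ∈ dehomIdeal c (JIdeal f (linFormOf v ^ e)) ↔ (e : ℕ∞) ≤ (phiHom f v w c h).order := by
  have hom : ∀ {D} {H : MvPolynomial (Fin 3) K}, H.IsHomogeneous D →
      (linFormOf v ^ e ∣ aeval f H ↔ (e : ℕ∞) ≤ (phiHom f v w c (aeval (dehomMap c) H)).order) := by
    intro D H hH
    rw [phi_order f v w c hc hH]
    exact theta_dvd_iff hvw (hH.aeval f hf) e
  constructor
  · intro hh
    have h1 : dehomIdeal c (JIdeal f (linFormOf v ^ e)) ≤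
        (Ideal.span {PowerSeries.X ^ e}).comap (phiHom f v w c) := by
      rw [dehomIdeal, Ideal.map_le_iff_le_comap, JIdeal, Ideal.span_le]
      rintro H ⟨⟨D, hD⟩, hdvd⟩
      change phiHom f v w c (aeval (dehomMap c) H) ∈ Ideal.span {PowerSeries.X ^ e}
      rw [Ideal.mem_span_singleton, ← order_ge_iff]
      exact (hom hD).mp hdvd
    have h2 := h1 hh
    rw [Ideal.mem_comap, Ideal.mem_span_singleton, ← order_ge_iff] at h2
    exact h2
  · intro hh
    obtain ⟨D, H, hH, rfl⟩ := homogenize c h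
    exact Ideal.mem_map_of_mem _ (Ideal.subset_span ⟨⟨D, hH⟩, (hom hH).mpr hh⟩)

/-- `k` is an order of vanishing of a form along the parameterization at `v`. -/
def OrdSet {K : Type*} [Field K] (f : Fin 3 → MvPolynomial (Fin 2) K)
    (v w : Fin 2 → K) (k : ℕ) : Prop :=
  ∃ D, ∃ H : MvPolynomial (Fin 3) K, H.IsHomogeneous D ∧ (thetaHom v w (aeval f H)).order = k

theorem ordSet_iff {K : Type*} [Field K] (f : Fin 3 → MvPolynomial (Fin 2) K)
    (v w : Fin 2 → K) (c : Fin 3) (hc : eval v (f c) ≠ 0) (k : ℕ) :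
    OrdSet f v w k ↔ ∃ h, (phiHom f v w c h).order = k := by
  constructor
  · rintro ⟨D, H, hH, h⟩
    exact ⟨_, (phi_order f v w c hc hH).trans h⟩
  · rintro ⟨h, hh⟩
    obtain ⟨D, H, hH, rfl⟩ := homogenize c h
    exact ⟨D, H, hH, (phi_order f v w c hc hH).symm.trans hh⟩

theorem curv_iff {K : Type*} [Field K] {n : ℕ} (f : Fin 3 → MvPolynomial (Fin 2) K)
    (hf : ∀ j, (f j).IsHomogeneous n)
    {v w : Fin 2 → K} (hvw : v 1 * w 0 - v 0 * w 1 = 1) (p : Fin 3 → K) (hp : p ≠ 0)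
    (l : K) (hl : l ≠ 0) (hv : ∀ j, eval v (f j) = l * p j) (h2 : OrdSet f v w 2) (t : ℕ) :
    CurvilinearOfLength (JIdeal f (linFormOf v ^ (2 * t))) p t ↔
      ∀ k < t, ¬ OrdSet f v w (2 * k + 1) := by
  have main : ∀ c, p c ≠ 0 →
      (Nonempty ((LocalRingAt (dehomIdeal c (JIdeal f (linFormOf v ^ (2 * t)))) (affOf p c)) ≃ₐ[K]
      (Polynomial K ⧸ Ideal.span {(Polynomial.X : Polynomial K) ^ t})) ↔
      ∀ k < t, ¬ OrdSet f v w (2 * k + 1)) := by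
    intro c hpc
    have hc : eval v (f c) ≠ 0 := by rw [hv]; exact mul_ne_zero hl hpc
    obtain ⟨ω, hω⟩ := (ordSet_iff f v w c hc 2).mp h2
    have hQ := dehom_J_iff f hf hvw c hc (2 * t)
    set Q := dehomIdeal c (JIdeal f (linFormOf v ^ (2 * t))) with hQdef
    have hcurv := aux_curv (phiHom f v w c) ω hω t Q hQ
    have hu : ∀ s, eval (affOf p c) s ≠ 0 → IsUnit (Ideal.Quotient.mk Q s) := by
      intro s hs
      have hnil : IsNilpotent (Ideal.Quotient.mk Q (s - C (eval (affOf p c) s))) := by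
        refine ⟨2 * t, ?_⟩
        rw [← map_pow, Ideal.Quotient.eq_zero_iff_mem, hQ, map_pow, order_ge_iff]
        apply pow_dvd_pow_of_dvd
        rw [PowerSeries.X_dvd_iff, phi_cc f v w c p l hl hv]
        simp
      have hC : IsUnit (Ideal.Quotient.mk Q (C (eval (affOf p c) s))) :=
        ((IsUnit.mk0 _ hs).map C).map _
      have := hnil.isUnit_add_left_of_commute hC (Commute.all _ _)
      rwa [← map_add, add_sub_cancel] at this
    obtain ⟨e⟩ := lr_equiv Q (affOf p c) hu
    rw [show (∀ k < t, ¬ OrdSet f v w (2 * k + 1)) ↔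
      (∀ h, ∀ k < t, (phiHom f v w c h).order ≠ (2 * k + 1 : ℕ)) from ?_, ← hcurv]
    · exact ⟨fun ⟨g⟩ => ⟨e.symm.trans g⟩, fun ⟨g⟩ => ⟨e.trans g⟩⟩
    · constructor
      · intro h g k hk hg
        exact h k hk ((ordSet_iff f v w c hc _).mpr ⟨g, hg⟩)
      · intro h k hk hg
        obtain ⟨g, hg⟩ := (ordSet_iff f v w c hc _).mp hg
        exact h g k hk hg
  constructor
  · intro h
    obtain ⟨c, hpc⟩ : ∃ c, p c ≠ 0 := by
      by_contra! h0; exact hp (funext h0)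
    exact (main c hpc).mp (h c hpc)
  · intro h c hpc
    exact (main c hpc).mpr h

/-- adapted coordinates at a point of the chart `c` -/
noncomputable def tFun {K : Type*} [Field K] (a : Fin 2 → K) (c : Fin 3) (j : Fin 3) :
    MvPolynomial (Fin 3) K :=
  if j = c then X 0 else rename Fin.succ (dehomMap c j) + C (eval a (dehomMap c j)) * X 0

/-- inverse change of coordinates -/
noncomputable def sFun {K : Type*} [Field K] (a : Fin 2 → K) (c : Fin 3) :
    Fin 3 → MvPolynomial (Fin 3) K :=
  Fin.cons (X c) (fun i => X (chartEmb c i) - C (a i) * X c)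

theorem tFun_self {K : Type*} [Field K] (a : Fin 2 → K) (c : Fin 3) : tFun a c c = X 0 := by
  simp [tFun]

theorem tFun_emb {K : Type*} [Field K] (a : Fin 2 → K) (c : Fin 3) (i : Fin 2) :
    tFun a c (chartEmb c i) = X i.succ + C (a i) * X 0 := by
  simp [tFun, emb_ne, dehom_emb]

theorem sFun_zero {K : Type*} [Field K] (a : Fin 2 → K) (c : Fin 3) : sFun a c 0 = X c := rfl

theorem sFun_succ {K : Type*} [Field K] (a : Fin 2 → K) (c : Fin 3) (i : Fin 2) :
    sFun a c i.succ = X (chartEmb c i) - C (a i) * X c := rfl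

/-- the linear change of coordinates -/
noncomputable def tEquiv {K : Type*} [Field K] (a : Fin 2 → K) (c : Fin 3) :
    MvPolynomial (Fin 3) K ≃ₐ[K] MvPolynomial (Fin 3) K :=
  AlgEquiv.ofAlgHom (aeval (tFun a c)) (aeval (sFun a c))
    (by
      apply MvPolynomial.algHom_ext
      intro j
      refine Fin.cases ?_ (fun i => ?_) j
      · simp [sFun_zero, tFun_self]
      · simp [sFun_succ, tFun_self, tFun_emb])
    (by
      apply MvPolynomial.algHom_ext
      intro j
      rcases chart_cases c j with rfl | ⟨i, rfl⟩
      · simp [sFun_zero, tFun_self]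
      · simp [sFun_succ, tFun_emb, sFun_zero])

theorem tEquiv_apply {K : Type*} [Field K] (a : Fin 2 → K) (c : Fin 3) (h) :
    tEquiv a c h = aeval (tFun a c) h := rfl

theorem tEquiv_symm_apply {K : Type*} [Field K] (a : Fin 2 → K) (c : Fin 3) (h) :
    (tEquiv a c).symm h = aeval (sFun a c) h := rfl

theorem tEquiv_hom {K : Type*} [Field K] (a : Fin 2 → K) (c : Fin 3) {D : ℕ}
    {h : MvPolynomial (Fin 3) K} (hh : h.IsHomogeneous D) : (tEquiv a c h).IsHomogeneous D := by
  have := hh.aeval (tFun a c) (n := 1) (fun j => by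
    rcases chart_cases c j with rfl | ⟨i, rfl⟩
    · rw [tFun_self]; exact isHomogeneous_X _ _
    · rw [tFun_emb]; exact (isHomogeneous_X _ _).add (isHomogeneous_C_mul_X _ _))
  rw [tEquiv_apply]; simpa using this

/-- the transformed equation, as a polynomial in the coordinate `w_c` -/
noncomputable def hatF {K : Type*} [Field K] (a : Fin 2 → K) (c : Fin 3) :
    MvPolynomial (Fin 3) K ≃ₐ[K] Polynomial (MvPolynomial (Fin 2) K) :=
  (tEquiv a c).trans (finSuccEquiv K 2)

theorem hatF_coeff_hom {K : Type*} [Field K] (a : Fin 2 → K) (c : Fin 3) {D : ℕ}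
    {h : MvPolynomial (Fin 3) K} (hh : h.IsHomogeneous D) (i j : ℕ) (hij : i + j = D) :
    ((hatF a c h).coeff i).IsHomogeneous j :=
  (tEquiv_hom a c hh).finSuccEquiv_coeff_isHomogeneous i j hij

theorem hatF_coeff_zero {K : Type*} [Field K] (a : Fin 2 → K) (c : Fin 3) {D : ℕ}
    {h : MvPolynomial (Fin 3) K} (hh : h.IsHomogeneous D) (i : ℕ) (hi : D < i) :
    (hatF a c h).coeff i = 0 := by
  ext μ
  change coeff μ (Polynomial.coeff (finSuccEquiv K 2 (tEquiv a c h)) i) = _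
  rw [finSuccEquiv_coeff_coeff, coeff_zero]
  apply (tEquiv_hom a c hh).coeff_eq_zero
  rw [Finsupp.degree_eq_sum, Fin.sum_univ_succ]
  simp
  omega

theorem aff_pt {K : Type*} [Field K] (p : Fin 3 → K) (c : Fin 3) (hc : p c ≠ 0) (i : Fin 2) :
    affOf p c i * p c = p (chartEmb c i) := by
  rw [affOf, div_mul_cancel₀ _ hc]

theorem mult_facts {K : Type*} [Field K] {F : MvPolynomial (Fin 3) K} {p : Fin 3 → K}
    (h : multAt F p = 2) : F ∈ pointIdeal p ^ 2 ∧ F ∉ pointIdeal p ^ 3 := by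
  have hb : BddAbove {m | F ∈ pointIdeal p ^ m} := by
    by_contra hb
    rw [multAt, csSup_of_not_bddAbove hb] at h
    simp at h
  have hne : {m | F ∈ pointIdeal p ^ m}.Nonempty := ⟨0, by simp⟩
  constructor
  · have := Nat.sSup_mem hne hb
    rw [multAt] at h
    rw [h] at this
    exact this
  · intro h3
    have := le_csSup hb (show 3 ∈ {m | F ∈ pointIdeal p ^ m} from h3)
    rw [multAt] at h
    omega

theorem eval_of_mult {K : Type*} [Field K] {F : MvPolynomial (Fin 3) K} {p : Fin 3 → K}
    (h : F ∈ pointIdeal p ^ 2) : eval p F = 0 := by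
  have h1 : pointIdeal p ≤ RingHom.ker (eval p) := by
    rw [pointIdeal, Ideal.span_le]
    rintro L ⟨-, hL⟩
    exact hL
  exact h1 (Ideal.pow_le_self (by norm_num) h)

theorem hatF_top {K : Type*} [Field K] {p : Fin 3 → K} {c : Fin 3} (hc : p c ≠ 0)
    {F : MvPolynomial (Fin 3) K} {n : ℕ} (hn : 3 ≤ n) (hF : F.IsHomogeneous n)
    (h3 : F ∉ pointIdeal p ^ 3) : ∃ i, n - 2 ≤ i ∧ i ≤ n ∧ (hatF (affOf p c) c F).coeff i ≠ 0 := by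
  by_contra! hcon
  apply h3
  set J : Ideal (MvPolynomial (Fin 3) K) := pointIdeal p with hJ
  have hs : ∀ i : Fin 2, sFun (affOf p c) c i.succ ∈ J := by
    intro i
    apply Ideal.subset_span
    rw [sFun_succ]
    refine ⟨(isHomogeneous_X _ _).sub (isHomogeneous_C_mul_X _ _), ?_⟩
    simp [aff_pt p c hc]
  have hT := tEquiv_hom (affOf p c) c hF
  rw [← (tEquiv (affOf p c) c).symm_apply_apply F, tEquiv_symm_apply]
  set H := tEquiv (affOf p c) c F with hH
  rw [H.as_sum, map_sum]
  apply Ideal.sum_mem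
  intro μ hμ
  have hdeg := hT.degree_eq_sum_deg_support hμ
  have h1 : μ 0 + (μ 1 + μ 2) = n := by
    have := hT (mem_support_iff.mp hμ)
    rw [Finsupp.weight_apply, Finsupp.sum_fintype _ _ (by simp)] at this
    simp [Fin.sum_univ_three] at this
    omega
  have h2 : 3 ≤ μ 1 + μ 2 := by
    by_contra hlt
    have h4 := hcon (μ 0) (by omega) (by omega)
    have h5 : coeff (Finsupp.tail μ) (Polynomial.coeff (finSuccEquiv K 2 H) (μ 0)) = coeff μ H := by
      rw [finSuccEquiv_coeff_coeff, Finsupp.cons_tail]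
    have h6 : Polynomial.coeff (finSuccEquiv K 2 H) (μ 0) = 0 := h4
    rw [h6, coeff_zero] at h5
    exact mem_support_iff.mp hμ h5.symm
  rw [aeval_monomial, Finsupp.prod_fintype _ _ (by simp), Fin.prod_univ_three]
  apply Ideal.mul_mem_left
  rw [mul_assoc]
  apply Ideal.mul_mem_left
  apply Ideal.pow_le_pow_right h2
  rw [pow_add]
  exact Ideal.mul_mem_mul (Ideal.pow_mem_pow (hs 0) _) (Ideal.pow_mem_pow (hs 1) _)

theorem not_mem_cube {K : Type*} [Field K] {p : Fin 3 → K} {c : Fin 3} (hc : p c ≠ 0)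
    {F : MvPolynomial (Fin 3) K} {n : ℕ} (hn : 3 ≤ n) (hF : F.IsHomogeneous n)
    (h3 : F ∉ pointIdeal p ^ 3) :
    aeval (dehomMap c) F ∉ (RingHom.ker (eval (affOf p c))) ^ 3 := by
  intro hmem
  obtain ⟨i, hi1, hi2, hi⟩ := hatF_top hc hn hF h3
  apply hi
  set a := affOf p c with ha
  let σ : MvPolynomial (Fin 2) K →ₐ[K] MvPolynomial (Fin 2) K := aeval (fun i => X i + C (a i))
  have hker : RingHom.ker (eval a) ≤ (idealOfVars (Fin 2) K).comap σ := by
    intro h hh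
    rw [Ideal.mem_comap]
    have h1 := mem_pow_idealOfVars_iff' (σ := Fin 2) (R := K) 1 (σ h)
    rw [pow_one] at h1
    rw [h1]
    intro x hx
    have hx0 : x = 0 := by
      have : x.degree = 0 := by omega
      exact (Finsupp.degree_eq_zero_iff x).mp this
    rw [hx0]
    have h2 : coeff 0 (σ h) = eval a h := by
      have : (constantCoeff : MvPolynomial (Fin 2) K →+* K).comp (σ : _ →+* _) = eval a := by
        apply MvPolynomial.ringHom_ext
        · intro r; simp [σ]
        · intro i; simp [σ]
      exact congrArg (fun g => g h) this
    rw [h2]; exact hh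
  have h1 : σ (aeval (dehomMap c) F) ∈ (idealOfVars (Fin 2) K) ^ 3 := by
    have := Ideal.pow_right_mono hker 3 hmem
    exact Ideal.le_comap_pow σ 3 this
  have h2 : σ (aeval (dehomMap c) F) = Polynomial.eval 1 (hatF a c F) := by
    have : (σ.comp (aeval (dehomMap c)) : MvPolynomial (Fin 3) K →+* _) =
        (Polynomial.evalRingHom (1 : MvPolynomial (Fin 2) K)).comp
          ((hatF a c : MvPolynomial (Fin 3) K →ₐ[K] Polynomial (MvPolynomial (Fin 2) K)) :
            MvPolynomial (Fin 3) K →+* Polynomial (MvPolynomial (Fin 2) K)) := by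
      apply MvPolynomial.ringHom_ext
      · intro r; simp [σ, hatF, tEquiv_apply, finSuccEquiv_apply]
      · intro j
        rcases chart_cases c j with rfl | ⟨i, rfl⟩
        · simp [hatF, tEquiv_apply, tFun_self, dehom_self, finSuccEquiv_X_zero]
        · simp [hatF, tEquiv_apply, tFun_emb, dehom_emb, σ, finSuccEquiv_X_succ,
            finSuccEquiv_X_zero, finSuccEquiv_apply]
    exact congrArg (fun g => g F) this
  rw [h2, Polynomial.eval_eq_sum_range' (n := n + 1), mem_pow_idealOfVars_iff'] at h1
  swap
  · rw [Nat.lt_succ_iff, Polynomial.natDegree_le_iff_coeff_eq_zero]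
    intro N hN
    exact hatF_coeff_zero a c hF N hN
  ext x
  rw [coeff_zero]
  have hhom := hatF_coeff_hom a c hF i (n - i) (by omega)
  by_cases hx : x.degree = n - i
  · have h5 := h1 x (by omega)
    rw [coeff_sum, Finset.sum_eq_single i] at h5
    · simpa using h5
    · intro k hk hki
      rw [one_pow, mul_one]
      have hk' := Finset.mem_range.mp hk
      exact (hatF_coeff_hom a c hF k (n - k) (by omega)).coeff_eq_zero (by omega)
    · intro h; exact absurd (Finset.mem_range.mpr (by omega)) h
  · exact hhom.coeff_eq_zero hx

theorem form_zero {K : Type*} [Field K] [IsAlgClosed K] {n : ℕ} (hn : 1 ≤ n)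
    {H : MvPolynomial (Fin 2) K} (hH : H.IsHomogeneous n) :
    ∃ v : Fin 2 → K, v ≠ 0 ∧ eval v H = 0 := by
  obtain ⟨c, hc⟩ := bin_form_expand hH
  by_cases h0 : c 0 = 0
  · refine ⟨![1, 0], fun h => by simpa using congrFun h 0, ?_⟩
    rw [hc, map_sum]
    apply Finset.sum_eq_zero
    intro k _
    by_cases hk : k = 0
    · simp [hk, h0]
    · simp [hk]
  · let P : Polynomial K := ∑ k ∈ Finset.range (n + 1), Polynomial.C (c k) * Polynomial.X ^ (n - k)
    have hcoeff : P.coeff n = c 0 := by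
      simp only [P, Polynomial.finsetSum_coeff, Polynomial.coeff_C_mul, Polynomial.coeff_X_pow]
      rw [Finset.sum_eq_single 0]
      · simp
      · intro k hk hk0
        rw [if_neg (by omega), mul_zero]
      · simp
    have hdeg : P.degree ≠ 0 := by
      intro hd
      have := Polynomial.coeff_eq_zero_of_degree_lt (p := P) (n := n)
        (by rw [hd]; exact_mod_cast hn)
      exact h0 (hcoeff ▸ this)
    obtain ⟨x, hx⟩ := IsAlgClosed.exists_root P hdeg
    refine ⟨![x, 1], fun h => by simpa using congrFun h 1, ?_⟩
    rw [Polynomial.IsRoot.def] at hx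
    simp only [P, Polynomial.eval_finsetSum] at hx
    rw [hc, map_sum]
    simpa using hx

theorem not_prop {K : Type*} [Field K] [IsAlgClosed K] {n : ℕ} (hn : 1 ≤ n)
    {f : Fin 3 → MvPolynomial (Fin 2) K} (hf : ∀ j, (f j).IsHomogeneous n)
    (hz : ∀ v : Fin 2 → K, v ≠ 0 → evalVec f v ≠ 0) (q : Fin 3 → K) (c : Fin 3) (hc : q c ≠ 0)
    (h : ∀ j, C (q c) * f j = C (q j) * f c) : False := by
  obtain ⟨v, hv, hv0⟩ := form_zero hn (hf c)
  apply hz v hv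
  ext j
  have := congrArg (eval v) (h j)
  simp [hv0, hc] at this
  exact this

theorem ker_lemma {K : Type*} [Field K] [IsAlgClosed K] {n : ℕ} (hn : 1 ≤ n)
    {f : Fin 3 → MvPolynomial (Fin 2) K} (hf : ∀ j, (f j).IsHomogeneous n)
    (hz : ∀ v : Fin 2 → K, v ≠ 0 → evalVec f v ≠ 0)
    {F : MvPolynomial (Fin 3) K} (hF : Irreducible F) (hFf : aeval f F = 0)
    {h : MvPolynomial (Fin 3) K} (hh : aeval f h = 0) : F ∣ h := by
  by_contra hnd
  let v : Fin 2 → K := ![1, 0]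
  have hv : v ≠ 0 := fun h => by simpa [v] using congrFun h 0
  obtain ⟨c, hc⟩ : ∃ c, eval v (f c) ≠ 0 := by
    by_contra! h0; exact hz v hv (funext h0)
  let γ : MvPolynomial (Fin 2) K →ₐ[K] Polynomial K :=
    aeval (fun i => Polynomial.X * Polynomial.C (v i))
  have hγ : ∀ j, γ (f j) = Polynomial.X ^ n * Polynomial.C (eval v (f j)) := by
    intro j
    simp only [γ]
    rw [hom_scale (hf j)]
    congr 1
    have : (aeval (fun i => Polynomial.C (v i)) : MvPolynomial (Fin 2) K →ₐ[K] Polynomial K) =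
        (Polynomial.CAlgHom : K →ₐ[K] Polynomial K).comp (aeval v) := by
      apply MvPolynomial.algHom_ext
      intro i; simp
    rw [this]; simp [aeval_eq_eval]
  let P0 : PrimeSpectrum (MvPolynomial (Fin 3) K) := ⟨⊥, Ideal.isPrime_bot⟩
  let P1 : PrimeSpectrum (MvPolynomial (Fin 3) K) :=
    ⟨Ideal.span {F}, (Ideal.span_singleton_prime hF.ne_zero).mpr hF.prime⟩
  let P2 : PrimeSpectrum (MvPolynomial (Fin 3) K) :=
    ⟨RingHom.ker (aeval f : MvPolynomial (Fin 3) K →ₐ[K] MvPolynomial (Fin 2) K),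
      RingHom.ker_isPrime _⟩
  let P3 : PrimeSpectrum (MvPolynomial (Fin 3) K) :=
    ⟨RingHom.ker (γ.comp (aeval f : MvPolynomial (Fin 3) K →ₐ[K] MvPolynomial (Fin 2) K)),
      RingHom.ker_isPrime _⟩
  let P4 : PrimeSpectrum (MvPolynomial (Fin 3) K) :=
    ⟨RingHom.ker (aeval (fun _ => 0) : MvPolynomial (Fin 3) K →ₐ[K] K), RingHom.ker_isPrime _⟩
  have l1 : P0 < P1 := by
    change (⊥ : Ideal _) < Ideal.span {F}
    rw [bot_lt_iff_ne_bot, Ne, Ideal.span_singleton_eq_bot]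
    exact hF.ne_zero
  have l2 : P1 < P2 := by
    change Ideal.span {F} < RingHom.ker (aeval f)
    refine lt_of_le_of_ne ((Ideal.span_singleton_le_iff_mem _).mpr hFf) ?_
    intro heq
    have : h ∈ Ideal.span {F} := by rw [heq]; exact hh
    exact hnd (Ideal.mem_span_singleton.mp this)
  have l3 : P2 < P3 := by
    change RingHom.ker (aeval f) < RingHom.ker (γ.comp (aeval f))
    refine lt_of_le_of_ne ?_ ?_
    · intro x hx
      rw [RingHom.mem_ker] at hx ⊢
      rw [AlgHom.comp_apply, hx, map_zero]
    · intro heq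
      refine not_prop hn hf hz (fun j => eval v (f j)) c hc (fun j => ?_)
      have : C (eval v (f c)) * X j - C (eval v (f j)) * X c ∈
          RingHom.ker (γ.comp (aeval f : MvPolynomial (Fin 3) K →ₐ[K] MvPolynomial (Fin 2) K)) := by
        rw [RingHom.mem_ker]
        simp only [map_sub, map_mul, algHom_C, AlgHom.comp_apply, aeval_X, hγ, AlgHom.commutes,
          Polynomial.algebraMap_apply, Algebra.algebraMap_self, RingHom.id_apply]
        ring
      rw [← heq, RingHom.mem_ker] at this
      simp only [map_sub, map_mul, algHom_C, aeval_X, algebraMap_eq] at this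
      exact sub_eq_zero.mp this
  have l4 : P3 < P4 := by
    change RingHom.ker (γ.comp (aeval f)) < RingHom.ker (aeval (fun _ => 0))
    have h0 : ∀ x : MvPolynomial (Fin 3) K,
        Polynomial.aeval (0 : K) (γ (aeval f x)) = aeval (fun _ => (0 : K)) x := by
      intro x
      have : ((Polynomial.aeval (0 : K)).comp (γ.comp (aeval f)) : MvPolynomial (Fin 3) K →ₐ[K] K)
          = aeval (fun _ => (0 : K)) := by
        apply MvPolynomial.algHom_ext
        intro j
        simp only [AlgHom.comp_apply, aeval_X, hγ]
        simp [show n ≠ 0 by omega]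
      exact congrArg (fun g => g x) this
    refine lt_of_le_of_ne ?_ ?_
    · intro x hx
      rw [RingHom.mem_ker] at hx ⊢
      rw [← h0]
      rw [AlgHom.comp_apply] at hx
      rw [hx, map_zero]
    · intro heq
      have : (X c : MvPolynomial (Fin 3) K) ∈
          RingHom.ker (γ.comp (aeval f : MvPolynomial (Fin 3) K →ₐ[K] MvPolynomial (Fin 2) K)) := by
        rw [heq, RingHom.mem_ker]; simp
      rw [RingHom.mem_ker, AlgHom.comp_apply, aeval_X, hγ] at this
      simp at this
      exact hc this
  let s : LTSeries (PrimeSpectrum (MvPolynomial (Fin 3) K)) :=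
    ⟨4, ![P0, P1, P2, P3, P4], by
      intro i; fin_cases i
      · exact l1
      · exact l2
      · exact l3
      · exact l4⟩
  have hle : ((4 : ℕ) : WithBot ℕ∞) ≤ ringKrullDim (MvPolynomial (Fin 3) K) :=
    Order.LTSeries.length_le_krullDim s
  rw [MvPolynomial.ringKrullDim_of_isNoetherianRing, ringKrullDim_eq_zero_of_field] at hle
  simp at hle
  exact absurd hle (by decide)

theorem val_mem {K Ω : Type*} [Field K] [IsAlgClosed K] [Field Ω] [Algebra K Ω] {n : ℕ} (hn : 1 ≤ n)
    {AB : Fin 2 → MvPolynomial (Fin 2) K} (hAB : ∀ i, (AB i).IsHomogeneous n)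
    (hz : ∀ v : Fin 2 → K, v ≠ 0 → ∃ i, eval v (AB i) ≠ 0)
    (ι : MvPolynomial (Fin 2) K →ₐ[K] Ω) (V : ValuationSubring Ω)
    (hVK : ∀ r : K, algebraMap K Ω r ∈ V) (hVA : ∀ i, ι (AB i) ∈ V)
    (i j : Fin 2) (hij : ∀ k, k = i ∨ k = j) (hne : j ≠ i) (hx0 : ι (X i) ≠ 0)
    (hu : ι (X j) / ι (X i) ∈ V) (k : Fin 2) : ι (X k) ∈ V := by
  set x := ι (X i) with hx
  set y := ι (X j) with hy
  set u := y / x with hu'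
  have hyx : x * u = y := mul_div_cancel₀ y hx0
  let τ : MvPolynomial (Fin 2) K →ₐ[K] Polynomial K :=
    aeval (fun k => if k = i then 1 else Polynomial.X)
  have hτ : ∀ l, ι (AB l) = x ^ n * Polynomial.aeval u (τ (AB l)) := by
    intro l
    have h1 : ι = aeval (fun k => x * (if k = i then 1 else u)) := by
      apply MvPolynomial.algHom_ext
      intro k
      rw [aeval_X]
      rcases hij k with rfl | rfl
      · simp [hx]
      · rw [if_neg hne, hyx]
    have h2 : (Polynomial.aeval u).comp τ = aeval (fun k => (if k = i then 1 else u)) := by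
      apply MvPolynomial.algHom_ext
      intro k
      simp only [τ, AlgHom.comp_apply, aeval_X]
      split_ifs <;> simp
    conv_lhs => rw [h1]
    rw [hom_scale (hAB l), ← h2, AlgHom.comp_apply]
  have hcop : IsCoprime (τ (AB 0)) (τ (AB 1)) := by
    refine (Polynomial.isCoprime_iff_aeval_ne_zero_of_isAlgClosed (k := K) (K := K) _ _).mpr ?_
    intro t
    have h1 : ∀ h, Polynomial.aeval t (τ h) = eval (fun k => (if k = i then 1 else t)) h := by
      intro h
      have : (Polynomial.aeval t).comp τ = aeval (fun k => (if k = i then 1 else t)) := by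
        apply MvPolynomial.algHom_ext
        intro k
        simp only [τ, AlgHom.comp_apply, aeval_X]
        split_ifs <;> simp
      rw [← AlgHom.comp_apply, this, aeval_eq_eval]
    rw [h1, h1]
    obtain ⟨l, hl⟩ := hz (fun k => (if k = i then 1 else t))
      (fun h => by simpa using congrFun h i)
    fin_cases l
    · exact Or.inl hl
    · exact Or.inr hl
  obtain ⟨α, β, hab⟩ := hcop
  have hpoly : ∀ q : Polynomial K, Polynomial.aeval u q ∈ V := by
    intro q
    rw [Polynomial.aeval_eq_sum_range]
    apply sum_mem
    intro l _
    rw [Algebra.smul_def]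
    exact mul_mem (hVK _) (pow_mem hu _)
  have hxn : x ^ n ∈ V := by
    have h1 := congrArg (Polynomial.aeval u) hab
    rw [map_add, map_mul, map_mul, map_one] at h1
    have h2 : x ^ n = Polynomial.aeval u α * ι (AB 0) + Polynomial.aeval u β * ι (AB 1) := by
      rw [hτ, hτ]; linear_combination -x ^ n * h1
    rw [h2]
    exact add_mem (mul_mem (hpoly _) (hVA _)) (mul_mem (hpoly _) (hVA _))
  have hxV : x ∈ V := by
    rcases V.mem_or_inv_mem x with h | h
    · exact h
    · obtain ⟨l, rfl⟩ : ∃ l, n = l + 1 := ⟨n - 1, by omega⟩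
      have : x = x ^ (l + 1) * x⁻¹ ^ l := by
        rw [pow_succ, mul_right_comm, ← mul_pow, mul_inv_cancel₀ hx0, one_pow, one_mul]
      rw [this]
      exact mul_mem hxn (pow_mem h _)
  rcases hij k with rfl | rfl
  · exact hxV
  · change y ∈ V
    rw [← hyx]; exact mul_mem hxV hu

theorem integral_rel {K : Type*} [Field K] [IsAlgClosed K] {n : ℕ} (hn : 1 ≤ n)
    {AB : Fin 2 → MvPolynomial (Fin 2) K} (hAB : ∀ i, (AB i).IsHomogeneous n)
    (hz : ∀ v : Fin 2 → K, v ≠ 0 → ∃ i, eval v (AB i) ≠ 0) (H : MvPolynomial (Fin 2) K) :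
    ∃ q : Polynomial (MvPolynomial (Fin 2) K), q.Monic ∧
      Polynomial.eval₂ ((aeval AB : MvPolynomial (Fin 2) K →ₐ[K] MvPolynomial (Fin 2) K) :
        MvPolynomial (Fin 2) K →+* MvPolynomial (Fin 2) K) H q = 0 := by
  let Ω := FractionRing (MvPolynomial (Fin 2) K)
  let ι : MvPolynomial (Fin 2) K →ₐ[K] Ω := IsScalarTower.toAlgHom K _ Ω
  have hι : Function.Injective ι := IsFractionRing.injective _ _
  let ρ : MvPolynomial (Fin 2) K →ₐ[K] Ω := ι.comp (aeval AB)
  let S : Set Ω := Set.range ρ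
  have hmem : ι H ∈ (integralClosure (Subring.closure S) Ω).toSubring := by
    rw [← iInf_valuationSubring_superset, Subring.mem_iInf]
    rintro ⟨V, hV⟩
    have hVK : ∀ r : K, algebraMap K Ω r ∈ V := fun r => hV ⟨C r, by
      rw [← algebraMap_eq, AlgHom.commutes]⟩
    have hVA : ∀ i, ι (AB i) ∈ V := fun i => hV ⟨X i, by simp [ρ]⟩
    have hX : ∀ k, ι (X k) ∈ V := by
      have h0 : ∀ k, ι (X k) ≠ 0 := fun k h =>
        X_ne_zero (R := K) k (hι (by rw [h, map_zero]))
      rcases V.mem_or_inv_mem (ι (X 1) / ι (X 0)) with h | h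
      · exact val_mem hn hAB hz ι V hVK hVA 0 1 (by decide) (by decide) (h0 0) h
      · rw [inv_div] at h
        exact val_mem hn hAB hz ι V hVK hVA 1 0 (by decide) (by decide) (h0 1) h
    change ι H ∈ V
    induction H using MvPolynomial.induction_on with
    | C r => rw [← algebraMap_eq, AlgHom.commutes]; exact hVK r
    | add p q hp hq => rw [map_add]; exact add_mem hp hq
    | mul_X p i hp => rw [map_mul]; exact mul_mem hp (hX i)
  have hint : IsIntegral (Subring.closure S) (ι H) := hmem
  obtain ⟨P, hP, hP0⟩ := hint
  have hcl : ∀ x ∈ Subring.closure S, x ∈ S := by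
    have : S = ((ρ : MvPolynomial (Fin 2) K →+* Ω).range : Set Ω) := by
      ext; simp [S]
    rw [this, Subring.closure_eq]
    exact fun x hx => hx
  have hlift : P.map (algebraMap (Subring.closure S) Ω) ∈
      Polynomial.lifts (ρ : MvPolynomial (Fin 2) K →+* Ω) := by
    rw [Polynomial.lifts_iff_coeff_lifts]
    intro k
    rw [Polynomial.coeff_map]
    exact hcl _ (P.coeff k).2
  obtain ⟨q, hq, -, hqm⟩ := Polynomial.lifts_and_natDegree_eq_and_monic hlift (hP.map _)
  refine ⟨q, hqm, hι ?_⟩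
  rw [map_zero]
  have h1 : Polynomial.eval (ι H) (q.map (ρ : MvPolynomial (Fin 2) K →+* Ω)) = 0 := by
    rw [hq, Polynomial.eval_map]; exact hP0
  rw [← h1, Polynomial.eval_map]
  exact Polynomial.hom_eval₂ q _ (ι : MvPolynomial (Fin 2) K →+* Ω) H

/-- the projected parameterization -/
noncomputable def abFun {K : Type*} [Field K] (f : Fin 3 → MvPolynomial (Fin 2) K) (a : Fin 2 → K)
    (c : Fin 3) (i : Fin 2) : MvPolynomial (Fin 2) K := f (chartEmb c i) - C (a i) * f c

theorem hat_eval {K : Type*} [Field K] (f : Fin 3 → MvPolynomial (Fin 2) K) (a : Fin 2 → K)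
    (c : Fin 3) (h : MvPolynomial (Fin 3) K) :
    Polynomial.eval₂ ((aeval (abFun f a c) : MvPolynomial (Fin 2) K →ₐ[K] MvPolynomial (Fin 2) K) :
        MvPolynomial (Fin 2) K →+* MvPolynomial (Fin 2) K) (f c) (hatF a c h) = aeval f h := by
  have : (Polynomial.eval₂RingHom ((aeval (abFun f a c) :
        MvPolynomial (Fin 2) K →ₐ[K] MvPolynomial (Fin 2) K) :
        MvPolynomial (Fin 2) K →+* MvPolynomial (Fin 2) K) (f c)).comp
          ((hatF a c : MvPolynomial (Fin 3) K →ₐ[K] Polynomial (MvPolynomial (Fin 2) K)) :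
            MvPolynomial (Fin 3) K →+* Polynomial (MvPolynomial (Fin 2) K)) =
      ((aeval f : MvPolynomial (Fin 3) K →ₐ[K] MvPolynomial (Fin 2) K) :
        MvPolynomial (Fin 3) K →+* MvPolynomial (Fin 2) K) := by
    apply MvPolynomial.ringHom_ext
    · intro r; simp [hatF, tEquiv_apply, finSuccEquiv_apply]
    · intro j
      rcases chart_cases c j with rfl | ⟨i, rfl⟩
      · simp [hatF, tEquiv_apply, tFun_self, finSuccEquiv_X_zero]
      · simp [hatF, tEquiv_apply, tFun_emb, finSuccEquiv_apply, abFun]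
  exact congrArg (fun g => g h) this

theorem hat_dvd {K : Type*} [Field K] [IsAlgClosed K] {n : ℕ} (hn : 1 ≤ n)
    {f : Fin 3 → MvPolynomial (Fin 2) K} (hf : ∀ j, (f j).IsHomogeneous n)
    (hz : ∀ v : Fin 2 → K, v ≠ 0 → evalVec f v ≠ 0)
    {F : MvPolynomial (Fin 3) K} (hF : Irreducible F) (hFf : aeval f F = 0)
    (a : Fin 2 → K) (c : Fin 3) (q : Polynomial (MvPolynomial (Fin 2) K))
    (hq : Polynomial.eval₂ ((aeval (abFun f a c) :
        MvPolynomial (Fin 2) K →ₐ[K] MvPolynomial (Fin 2) K) :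
        MvPolynomial (Fin 2) K →+* MvPolynomial (Fin 2) K) (f c) q = 0) : hatF a c F ∣ q := by
  rw [← (hatF a c).apply_symm_apply q] at hq ⊢
  rw [hat_eval] at hq
  exact map_dvd (hatF a c) (ker_lemma hn hf hz hF hFf hq)

theorem exists_preimage {K : Type*} [Field K] [IsAlgClosed K] {n : ℕ} (hn : 1 ≤ n)
    {f : Fin 3 → MvPolynomial (Fin 2) K} (hf : ∀ j, (f j).IsHomogeneous n)
    (hz : ∀ v : Fin 2 → K, v ≠ 0 → evalVec f v ≠ 0)
    {F : MvPolynomial (Fin 3) K} (hF : Irreducible F) (hFhom : F.IsHomogeneous n)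
    (hFf : aeval f F = 0)
    {p : Fin 3 → K} {c : Fin 3} (hc : p c ≠ 0) (hFp : eval p F = 0) :
    ∃ v : Fin 2 → K, v ≠ 0 ∧ ∀ i, eval v (abFun f (affOf p c) c i) = 0 := by
  by_contra! hcon
  set a := affOf p c with ha
  have hAB : ∀ i, (abFun f a c i).IsHomogeneous n := fun i =>
    (hf _).sub ((hf c).C_mul _)
  obtain ⟨q, hqm, hq⟩ := integral_rel hn hAB hcon (f c)
  obtain ⟨r, hr⟩ := hat_dvd hn hf hz hF hFf a c q hq
  have hlead : IsUnit (hatF a c F).leadingCoeff := by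
    have h1 : q.leadingCoeff = 1 := hqm
    rw [hr, Polynomial.leadingCoeff_mul] at h1
    exact IsUnit.of_mul_eq_one _ h1
  set e := (hatF a c F).natDegree with he
  have hne : (hatF a c F).coeff e ≠ 0 := hlead.ne_zero
  have hen : e ≤ n := by
    by_contra hlt
    exact hne (hatF_coeff_zero a c hFhom e (by omega))
  have hhom := hatF_coeff_hom a c hFhom e (n - e) (by omega)
  have h0 : ((hatF a c F).coeff e).IsHomogeneous 0 := by
    obtain ⟨k, hk, hk'⟩ := (MvPolynomial.isUnit_iff_eq_C_of_isReduced).mp hlead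
    change (hatF a c F).coeff e = C k at hk'
    rw [hk']; exact isHomogeneous_C _ _
  have hee : n - e = 0 := hhom.inj_right h0 hne
  have hen' : e = n := by omega
  -- evaluate at the point
  have h5 : eval p F = p c ^ n * eval (fun _ => 0) ((hatF a c F).coeff n) := by
    have h6 : Polynomial.eval₂ (eval (fun _ => (0 : K))) (p c) (hatF a c F) = eval p F := by
      have : (Polynomial.eval₂RingHom (eval (fun _ => (0 : K))) (p c)).comp
          ((hatF a c : MvPolynomial (Fin 3) K →ₐ[K] Polynomial (MvPolynomial (Fin 2) K)) :
            MvPolynomial (Fin 3) K →+* Polynomial (MvPolynomial (Fin 2) K)) = eval p := by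
        apply MvPolynomial.ringHom_ext
        · intro r; simp [hatF, tEquiv_apply, finSuccEquiv_apply]
        · intro j
          rcases chart_cases c j with rfl | ⟨i, rfl⟩
          · simp [hatF, tEquiv_apply, tFun_self, finSuccEquiv_X_zero]
          · simp [hatF, tEquiv_apply, tFun_emb, finSuccEquiv_apply, ha, aff_pt p c hc]
      exact congrArg (fun g => g F) this
    rw [← h6, Polynomial.eval₂_eq_sum_range, ← he, hen', Finset.sum_eq_single n, mul_comm]
    · intro k hk hkn
      have hk' := Finset.mem_range.mp hk
      have h7 := hatF_coeff_hom a c hFhom k (n - k) (by omega)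
      have h8 : eval (fun _ => (0 : K)) ((hatF a c F).coeff k) = 0 := by
        have h9 := h7.coeff_eq_zero (d := 0) (by simp; omega)
        rw [← constantCoeff_eq] at h9
        rw [eval_zero']; exact h9
      rw [h8, zero_mul]
    · simp
  rw [hFp] at h5
  have hl' : IsUnit ((hatF a c F).coeff e) := hlead
  rw [hen'] at hl'
  have h10 := hl'.map (eval (fun _ => (0 : K)))
  exact mul_ne_zero (pow_ne_zero n hc) h10.ne_zero h5.symm

theorem hom_of_mul {K : Type*} [Field K] {g k : MvPolynomial (Fin 2) K} {n : ℕ}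
    (h : (g * k).IsHomogeneous n) (hg : g ≠ 0) (hk : k ≠ 0) :
    ∃ d e, g.IsHomogeneous d ∧ k.IsHomogeneous e ∧ d + e = n := by
  let R := MvPolynomial (Fin 2) K
  let φ : R →ₐ[K] Polynomial R := aeval (fun i => Polynomial.X * Polynomial.C (X i))
  have hC : ∀ q : R, aeval (fun i => (Polynomial.C (X i) : Polynomial R)) q = Polynomial.C q := by
    intro q
    have : (aeval (fun i => (Polynomial.C (X i) : Polynomial R)) : R →ₐ[K] Polynomial R) =
        (Polynomial.CAlgHom : R →ₐ[R] Polynomial R).restrictScalars K := by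
      apply MvPolynomial.algHom_ext
      intro i; simp [Polynomial.CAlgHom]
    rw [this]; rfl
  have hφh : ∀ (q : R) (D : ℕ), q.IsHomogeneous D → φ q = Polynomial.C q * Polynomial.X ^ D := by
    intro q D hq
    change aeval _ q = _
    rw [hom_scale hq, hC, mul_comm]
  have hcoeff : ∀ (q : R) (j : ℕ), (φ q).coeff j = homogeneousComponent j q := by
    intro q j
    conv_lhs => rw [← sum_homogeneousComponent q]
    rw [map_sum, Polynomial.finsetSum_coeff]
    rw [Finset.sum_congr rfl (fun i _ => by
      rw [hφh _ i (homogeneousComponent_isHomogeneous i q), Polynomial.coeff_C_mul_X_pow])]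
    rw [Finset.sum_ite_eq]
    split_ifs with hj
    · rfl
    · rw [homogeneousComponent_eq_zero]
      simpa using hj
  have hinj : ∀ q : R, q ≠ 0 → φ q ≠ 0 := by
    intro q hq h0
    apply hq
    rw [← sum_homogeneousComponent q]
    apply Finset.sum_eq_zero
    intro i _
    rw [← hcoeff, h0, Polynomial.coeff_zero]
  have hmono : ∀ q : R, q ≠ 0 → (φ q).natTrailingDegree = (φ q).natDegree →
      q.IsHomogeneous (φ q).natDegree := by
    intro q hq hd
    have : q = homogeneousComponent (φ q).natDegree q := by
      conv_lhs => rw [← sum_homogeneousComponent q]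
      rw [Finset.sum_eq_single (φ q).natDegree]
      · intro j _ hj
        rw [← hcoeff]
        rcases lt_or_gt_of_ne hj with h1 | h1
        · exact Polynomial.coeff_eq_zero_of_lt_natTrailingDegree (by omega)
        · exact Polynomial.coeff_eq_zero_of_natDegree_lt h1
      · intro hn
        apply homogeneousComponent_eq_zero
        simpa using hn
    have h2 := homogeneousComponent_isHomogeneous (φ q).natDegree q
    rwa [← this] at h2
  have hgk : φ g * φ k = Polynomial.C (g * k) * Polynomial.X ^ n := by
    rw [← map_mul, hφh _ n h]
  have hd : (φ g).natDegree + (φ k).natDegree = n := by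
    rw [← Polynomial.natDegree_mul (hinj g hg) (hinj k hk), hgk,
      Polynomial.natDegree_C_mul_X_pow _ _ (mul_ne_zero hg hk)]
  have ht : (φ g).natTrailingDegree + (φ k).natTrailingDegree = n := by
    rw [← Polynomial.natTrailingDegree_mul (hinj g hg) (hinj k hk), hgk,
      Polynomial.C_mul_X_pow_eq_monomial, Polynomial.natTrailingDegree_monomial (mul_ne_zero hg hk)]
  have h1 := Polynomial.natTrailingDegree_le_natDegree (φ g)
  have h2 := Polynomial.natTrailingDegree_le_natDegree (φ k)
  exact ⟨_, _, hmono g hg (by omega), hmono k hk (by omega), hd⟩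

theorem count_rel {K : Type*} [Field K] {n d r : ℕ} (hdr : d + r = n)
    {G H : MvPolynomial (Fin 2) K} {A AB : Fin 2 → MvPolynomial (Fin 2) K}
    (hG : G.IsHomogeneous d) (hH : H.IsHomogeneous n) (hA : ∀ i, (A i).IsHomogeneous r)
    (hAB : ∀ i, AB i = G * A i) :
    ∃ q : Polynomial (MvPolynomial (Fin 2) K), q ≠ 0 ∧ q.natDegree ≤ r ∧
      Polynomial.eval₂ ((aeval AB : MvPolynomial (Fin 2) K →ₐ[K] MvPolynomial (Fin 2) K) :
        MvPolynomial (Fin 2) K →+* MvPolynomial (Fin 2) K) H q = 0 := by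
  classical
  set E := n * r + 1 with hE
  set N := r * E + n * r with hN
  let T : Fin (r + 1) × Fin (E + 1) → MvPolynomial (Fin 2) K := fun ij =>
    G ^ (r - ij.1) * A 0 ^ (r - ij.1 + (E - ij.2)) * A 1 ^ (ij.2 : ℕ) * H ^ (ij.1 : ℕ)
  have hT : ∀ ij, (T ij).IsHomogeneous N := by
    rintro ⟨i, j⟩
    have h1 := (((hG.pow (r - i)).mul ((hA 0).pow (r - i + (E - j)))).mul
      ((hA 1).pow (j : ℕ))).mul (hH.pow (i : ℕ))
    have h2 : d * (r - i) + r * (r - i + (E - j)) + r * j + n * i = N := by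
      obtain ⟨k, hk⟩ : ∃ k, r = i + k := ⟨r - i, by have := i.isLt; omega⟩
      obtain ⟨l, hl⟩ : ∃ l, E = j + l := ⟨E - j, by have := j.isLt; omega⟩
      have e1 : r - i = k := by omega
      have e2 : E - j = l := by omega
      rw [e1, e2, hN, ← hdr]
      have t1 : (k : ℤ) = r - i := by omega
      have t2 : (l : ℤ) = E - j := by omega
      clear_value E
      zify
      rw [t1, t2]; ring
    rw [h2] at h1
    exact h1
  let w : Finset (MvPolynomial (Fin 2) K) :=
    (Finset.range (N + 1)).image (fun k => X 0 ^ (N - k) * X 1 ^ k)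
  have hw : Set.range T ≤ Submodule.span K (w : Set (MvPolynomial (Fin 2) K)) := by
    rintro _ ⟨ij, rfl⟩
    obtain ⟨c, hc⟩ := bin_form_expand (hT ij)
    rw [SetLike.mem_coe, hc]
    apply sum_mem
    intro k hk
    rw [mul_assoc, ← smul_eq_C_mul]
    apply Submodule.smul_mem
    apply Submodule.subset_span
    exact Finset.mem_coe.mpr (Finset.mem_image.mpr ⟨k, hk, rfl⟩)
  have hnli : ¬ LinearIndependent K T := by
    intro hli
    have h1 := linearIndependent_le_span_aux' T hli (w : Set (MvPolynomial (Fin 2) K)) hw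
    have h2 : Fintype.card (w : Set (MvPolynomial (Fin 2) K)) ≤ N + 1 := by
      rw [show Fintype.card (w : Set (MvPolynomial (Fin 2) K)) = w.card from Fintype.card_coe w]
      exact (Finset.card_image_le).trans (by simp)
    rw [Fintype.card_prod, Fintype.card_fin, Fintype.card_fin] at h1
    have h3 : (r + 1) * (E + 1) = r * E + r + E + 1 := by ring
    omega
  obtain ⟨x, hx0, ⟨i0, j0⟩, hne⟩ := Fintype.not_linearIndependent_iff.mp hnli
  refine ⟨∑ ij : Fin (r + 1) × Fin (E + 1), Polynomial.monomial (ij.1 : ℕ)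
    (monomial (Finsupp.single 0 (r - ij.1 + (E - ij.2)) + Finsupp.single 1 (ij.2 : ℕ)) (x ij)), ?_, ?_, ?_⟩
  · intro h0
    apply hne
    have h1 := congrArg (fun q : Polynomial (MvPolynomial (Fin 2) K) =>
      coeff (Finsupp.single 0 (r - i0 + (E - j0)) + Finsupp.single 1 (j0 : ℕ)) (q.coeff (i0 : ℕ))) h0
    simp only [Polynomial.finsetSum_coeff, Polynomial.coeff_zero, coeff_zero, coeff_sum] at h1
    rw [Finset.sum_eq_single (i0, j0)] at h1
    · simpa using h1
    · rintro ⟨i, j⟩ _ hij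
      rw [Polynomial.coeff_monomial]
      split_ifs with h2
      · rw [coeff_monomial, if_neg]
        intro h3
        have h4 := DFunLike.congr_fun h3 1
        simp at h4
        apply hij
        ext
        · exact h2
        · exact h4
      · rfl
    · simp
  · apply Polynomial.natDegree_sum_le_of_forall_le
    intro ij _
    exact (Polynomial.natDegree_monomial_le _).trans (by have := ij.1.isLt; omega)
  · rw [Polynomial.eval₂_finsetSum]
    have : G ^ E * ∑ ij, x ij • T ij = 0 := by rw [hx0, mul_zero]
    rw [← this, Finset.mul_sum]
    apply Finset.sum_congr rfl
    rintro ⟨i, j⟩ _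
    rw [Polynomial.eval₂_monomial, RingHom.coe_coe, aeval_monomial]
    rw [Finsupp.prod_add_index' (by simp) (by intros; rw [pow_add])]
    rw [Finsupp.prod_single_index (by simp), Finsupp.prod_single_index (by simp)]
    simp only [T, hAB, smul_eq_C_mul, algebraMap_eq]
    have h5 : E = (E - j) + j := by have := j.isLt; omega
    have h6 : G ^ E = G ^ (E - j) * G ^ (j : ℕ) := by rw [← pow_add, ← h5]
    rw [h6]
    simp only [mul_pow, pow_add]
    ring

theorem gcd_deg {K : Type*} [Field K] [IsAlgClosed K] {n : ℕ} (hn : 3 ≤ n)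
    {f : Fin 3 → MvPolynomial (Fin 2) K} (hf : ∀ j, (f j).IsHomogeneous n)
    (hz : ∀ v : Fin 2 → K, v ≠ 0 → evalVec f v ≠ 0)
    {F : MvPolynomial (Fin 3) K} (hF : Irreducible F) (hFhom : F.IsHomogeneous n)
    (hFf : aeval f F = 0)
    {p : Fin 3 → K} {c : Fin 3} (hc : p c ≠ 0) (h3 : F ∉ pointIdeal p ^ 3)
    {d : ℕ} {G : MvPolynomial (Fin 2) K} (hG : G.IsHomogeneous d)
    (hdvd : ∀ i, G ∣ abFun f (affOf p c) c i)
    (hne : ∃ i, abFun f (affOf p c) c i ≠ 0) : d ≤ 2 := by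
  set a := affOf p c
  have hAB : ∀ i, (abFun f a c i).IsHomogeneous n := fun i =>
    (hf _).sub ((hf c).C_mul _)
  choose A hA using hdvd
  have hG0 : G ≠ 0 := by
    rintro rfl
    obtain ⟨i, hi⟩ := hne
    exact hi (by rw [hA, zero_mul])
  have hAe : ∀ i, A i ≠ 0 → d ≤ n ∧ (A i).IsHomogeneous (n - d) := by
    intro i hi
    have h1 := hAB i
    rw [hA] at h1
    obtain ⟨d', e, h2, h4, h5⟩ := hom_of_mul h1 hG0 hi
    have := h2.inj_right hG hG0
    subst this
    refine ⟨by omega, ?_⟩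
    rw [← h5, Nat.add_sub_cancel_left]; exact h4
  have hdn : d ≤ n := by
    obtain ⟨i, hi⟩ := hne
    exact (hAe i (fun h => hi (by rw [hA, h, mul_zero]))).1
  have hAh : ∀ i, (A i).IsHomogeneous (n - d) := by
    intro i
    by_cases hi : A i = 0
    · rw [hi]; exact isHomogeneous_zero _ _ _
    · exact (hAe i hi).2
  obtain ⟨q, hq0, hqd, hq⟩ := count_rel (by omega : d + (n - d) = n) hG (hf c) hAh hA
  have h6 := hat_dvd (by omega) hf hz hF hFf a c q hq
  obtain ⟨i, hi1, hi2, hi3⟩ := hatF_top hc hn hFhom h3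
  have h7 : i ≤ (hatF a c F).natDegree := Polynomial.le_natDegree_of_ne_zero hi3
  have h8 := Polynomial.natDegree_le_of_dvd h6 hq0
  omega

theorem cross_dvd_iff {K : Type*} [Field K] (f : Fin 3 → MvPolynomial (Fin 2) K) {p : Fin 3 → K}
    {c : Fin 3} (hc : p c ≠ 0) (D : MvPolynomial (Fin 2) K) :
    (∀ i j : Fin 3, i < j → D ∣ crossDiff f p i j) ↔ ∀ i, D ∣ abFun f (affOf p c) c i := by
  constructor
  · intro h i
    have hall : ∀ i j, D ∣ crossDiff f p i j := by
      intro i j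
      rcases lt_trichotomy i j with h1 | h1 | h1
      · exact h i j h1
      · subst h1; simp [crossDiff]
      · have := (h j i h1).neg_right
        rw [crossDiff, neg_sub] at this
        exact this
    have h1 : abFun f (affOf p c) c i = C ((p c)⁻¹) * crossDiff f p c (chartEmb c i) := by
      have h2 : (C (p c)⁻¹ : MvPolynomial (Fin 2) K) * C (p c) = 1 := by
        rw [← C_mul, inv_mul_cancel₀ hc, C_1]
      rw [abFun, crossDiff, affOf, div_eq_mul_inv, C_mul]
      linear_combination -f (chartEmb c i) * h2
    rw [h1]
    exact (hall _ _).mul_left _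
  · intro h i j _
    have hall : ∀ j, D ∣ f j - C (p j / p c) * f c := by
      intro j
      rcases chart_cases c j with rfl | ⟨i, rfl⟩
      · rw [div_self hc, C_1, one_mul, sub_self]; exact dvd_zero _
      · exact h i
    have h1 : crossDiff f p i j = C (p i) * (f j - C (p j / p c) * f c) -
        C (p j) * (f i - C (p i / p c) * f c) := by
      have h2 : (C (p i) * C (p j / p c) : MvPolynomial (Fin 2) K) = C (p j) * C (p i / p c) := by
        rw [← C_mul, ← C_mul]; congr 1; ring
      rw [crossDiff]
      linear_combination f c * h2
    rw [h1]
    exact dvd_sub ((hall j).mul_left _) ((hall i).mul_left _)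

theorem ab_hom {K : Type*} [Field K] {n : ℕ} {f : Fin 3 → MvPolynomial (Fin 2) K}
    (hf : ∀ j, (f j).IsHomogeneous n) (a : Fin 2 → K) (c : Fin 3) (i : Fin 2) :
    (abFun f a c i).IsHomogeneous n := (hf _).sub ((hf c).C_mul _)

theorem ab_order {K : Type*} [Field K] (f : Fin 3 → MvPolynomial (Fin 2) K)
    (v w : Fin 2 → K) (c : Fin 3) (hc : eval v (f c) ≠ 0) (a : Fin 2 → K) (i : Fin 2) :
    (phiHom f v w c (X i - C (a i))).order = (thetaHom v w (abFun f a c i)).order := by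
  have hh : (X (chartEmb c i) - C (a i) * X c : MvPolynomial (Fin 3) K).IsHomogeneous 1 :=
    (isHomogeneous_X _ _).sub (isHomogeneous_C_mul_X _ _)
  have := phi_order f v w c hc hh
  simpa [dehom_emb, dehom_self, abFun] using this

theorem ab_prop {K : Type*} [Field K] {f : Fin 3 → MvPolynomial (Fin 2) K}
    (hz : ∀ v : Fin 2 → K, v ≠ 0 → evalVec f v ≠ 0) {p : Fin 3 → K} {c : Fin 3} (hc : p c ≠ 0)
    {v : Fin 2 → K} (hv0 : v ≠ 0) (h : ∀ i, eval v (abFun f (affOf p c) c i) = 0) :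
    ∃ l : K, l ≠ 0 ∧ ∀ j, eval v (f j) = l * p j := by
  have h1 : ∀ j, eval v (f j) = eval v (f c) / p c * p j := by
    intro j
    rcases chart_cases c j with rfl | ⟨i, rfl⟩
    · rw [div_mul_cancel₀ _ hc]
    · have := h i
      rw [abFun, map_sub, map_mul, eval_C, affOf, sub_eq_zero] at this
      rw [this]; ring
  refine ⟨eval v (f c) / p c, ?_, h1⟩
  intro h0
  apply hz v hv0
  ext j
  change eval v (f j) = 0
  rw [h1 j, h0, zero_mul]

theorem lin_ne {K : Type*} [Field K] {v : Fin 2 → K} (hv0 : v ≠ 0) : linFormOf v ≠ 0 := by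
  intro h
  obtain ⟨w, hw⟩ := exists_dual hv0
  have := theta_lin hw
  rw [h, map_zero] at this
  exact PowerSeries.X_ne_zero this.symm

theorem lin_hom {K : Type*} [Field K] (v : Fin 2 → K) : (linFormOf v).IsHomogeneous 1 :=
  (isHomogeneous_C_mul_X _ _).sub (isHomogeneous_C_mul_X _ _)

theorem exact_two {K : Type*} [Field K] {n : ℕ} {f : Fin 3 → MvPolynomial (Fin 2) K}
    (hf : ∀ j, (f j).IsHomogeneous n) {v w : Fin 2 → K} (hvw : v 1 * w 0 - v 0 * w 1 = 1)
    {a : Fin 2 → K} {c : Fin 3} (h2 : ∀ i, linFormOf v ^ 2 ∣ abFun f a c i)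
    (h3 : ¬ ∀ i, linFormOf v ^ 3 ∣ abFun f a c i) :
    ∃ i, (thetaHom v w (abFun f a c i)).order = 2 := by
  push Not at h3
  obtain ⟨i, hi⟩ := h3
  refine ⟨i, ?_⟩
  have h4 := (theta_dvd_iff hvw (ab_hom hf a c i) 2).mp (h2 i)
  rw [theta_dvd_iff hvw (ab_hom hf a c i) 3, not_le] at hi
  apply le_antisymm _ h4
  exact Order.le_of_lt_add_one hi

theorem gcd_eq {K : Type*} [Field K] [IsAlgClosed K] {n : ℕ} (hn : 3 ≤ n)
    {f : Fin 3 → MvPolynomial (Fin 2) K} (hf : ∀ j, (f j).IsHomogeneous n)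
    (hz : ∀ v : Fin 2 → K, v ≠ 0 → evalVec f v ≠ 0)
    {F : MvPolynomial (Fin 3) K} (hF : Irreducible F) (hFhom : F.IsHomogeneous n)
    (hFf : aeval f F = 0)
    {p : Fin 3 → K} {c : Fin 3} (hc : p c ≠ 0) (h3 : F ∉ pointIdeal p ^ 3)
    {L : MvPolynomial (Fin 2) K} (hL : L.IsHomogeneous 1) (hL0 : L ≠ 0)
    (hdvd : ∀ i, L ^ 2 ∣ abFun f (affOf p c) c i) : IsGcdOfCross f p (L ^ 2) := by
  have hne : ∃ i, abFun f (affOf p c) c i ≠ 0 := by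
    by_contra! hcon
    apply not_prop (by omega) hf hz p c hc
    intro j
    rcases chart_cases c j with rfl | ⟨i, rfl⟩
    · rfl
    · have h1 := hcon i
      rw [abFun, sub_eq_zero] at h1
      rw [h1, ← aff_pt p c hc i, C_mul]; ring
  refine ⟨(cross_dvd_iff f hc _).mpr hdvd, fun D hD => ?_⟩
  rw [cross_dvd_iff f hc] at hD
  have : NormalizedGCDMonoid (MvPolynomial (Fin 2) K) :=
    Classical.choice inferInstance
  set g := gcd (abFun f (affOf p c) c 0) (abFun f (affOf p c) c 1) with hg
  have hgd : ∀ i, g ∣ abFun f (affOf p c) c i := by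
    intro i; fin_cases i
    · exact gcd_dvd_left _ _
    · exact gcd_dvd_right _ _
  have hDg : D ∣ g := dvd_gcd (hD 0) (hD 1)
  obtain ⟨k, hk⟩ : L ^ 2 ∣ g := dvd_gcd (hdvd 0) (hdvd 1)
  have hg0 : g ≠ 0 := by
    obtain ⟨i, hi⟩ := hne
    exact fun h => hi (zero_dvd_iff.mp (h ▸ hgd i))
  have hk0 : k ≠ 0 := by rintro rfl; exact hg0 (by rw [hk, mul_zero])
  obtain ⟨d, hd⟩ : ∃ d, g.IsHomogeneous d := by
    obtain ⟨i, hi⟩ := hne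
    obtain ⟨r, hr⟩ := hgd i
    have h1 := ab_hom hf (affOf p c) c i
    rw [hr] at h1
    obtain ⟨d, e, h2, -, -⟩ := hom_of_mul h1 hg0 (by rintro rfl; exact hi (by rw [hr, mul_zero]))
    exact ⟨d, h2⟩
  have hd2 := gcd_deg hn hf hz hF hFhom hFf hc h3 hd hgd hne
  rw [hk] at hd
  obtain ⟨d', e, h4, h5, h6⟩ := hom_of_mul hd (pow_ne_zero 2 hL0) hk0
  have h7 := h4.inj_right (hL.pow 2) (pow_ne_zero 2 hL0)
  have he : e = 0 := by omega
  subst he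
  have h8 : k = C (coeff 0 k) := by
    rw [← totalDegree_eq_zero_iff_eq_C]
    exact h5.totalDegree hk0
  have hu : IsUnit k := by
    rw [h8]
    refine IsUnit.map C (IsUnit.mk0 _ ?_)
    intro h; rw [h, C_0] at h8; exact hk0 h8
  rw [hk] at hDg
  exact (hu.dvd_mul_right).mp hDg

theorem aeval_ne {K : Type*} [Field K] {p : Fin 3 → K} (hp : p ≠ 0) : ∃ c, p c ≠ 0 := by
  by_contra! h
  exact hp (funext h)

theorem not_cube {K : Type*} [Field K] {f : Fin 3 → MvPolynomial (Fin 2) K} {p : Fin 3 → K}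
    {c : Fin 3} (hc : p c ≠ 0) {v : Fin 2 → K} (hv0 : v ≠ 0)
    (hg : IsGcdOfCross f p (linFormOf v ^ 2)) :
    ¬ ∀ i, linFormOf v ^ 3 ∣ abFun f (affOf p c) c i := by
  intro h
  rw [← cross_dvd_iff f hc] at h
  have h1 := hg.2 _ h
  obtain ⟨w, hw⟩ := exists_dual hv0
  rw [theta_dvd_iff hw ((lin_hom v).pow 2), map_pow, theta_lin hw, PowerSeries.order_X_pow] at h1
  have : 3 ≤ 2 := by exact_mod_cast h1
  omega

theorem adj_top {K : Type*} [Field K] (a : Fin 2 → K) (i j : Fin 2) (hij : ∀ k, k = i ∨ k = j) :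
    Algebra.adjoin K {(X i - C (a i) : MvPolynomial (Fin 2) K), X j - C (a j)} = ⊤ := by
  rw [eq_top_iff, ← adjoin_range_X, Algebra.adjoin_le_iff]
  rintro _ ⟨k, rfl⟩
  set S := Algebra.adjoin K {(X i - C (a i) : MvPolynomial (Fin 2) K), X j - C (a j)}
  have h1 : (X k - C (a k) : MvPolynomial (Fin 2) K) ∈ S := by
    apply Algebra.subset_adjoin
    rcases hij k with rfl | rfl
    · exact Or.inl rfl
    · exact Or.inr rfl
  have h2 : (C (a k) : MvPolynomial (Fin 2) K) ∈ S := S.algebraMap_mem (a k)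
  simpa using S.add_mem h1 h2

theorem main_iff {K : Type*} [Field K] [IsAlgClosed K] [CharZero K]
    (n : ℕ) (hn : 3 ≤ n) (f : Fin 3 → MvPolynomial (Fin 2) K)
    (hf : IsProperParam n f)
    (F : MvPolynomial (Fin 3) K) (hFirr : Irreducible F) (hFhom : F.IsHomogeneous n)
    (hFf : MvPolynomial.aeval f F = 0)
    (p : Fin 3 → K) (hp : p ≠ 0) (hmult : multAt F p = 2)
    (m : ℕ) (hm : 1 ≤ m) :
    IsAsSing F p (2 * m) ↔
      ∃ L : MvPolynomial (Fin 2) K,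
        L.IsHomogeneous 1 ∧ L ≠ 0 ∧
        IsGcdOfCross f p (L ^ 2) ∧
        CurvilinearOfLength (JIdeal f (L ^ (2 * m))) p m ∧
        (∀ t : ℕ, m < t → ¬ CurvilinearOfLength (JIdeal f (L ^ (2 * t))) p t) := by
  obtain ⟨hz, hF3⟩ := mult_facts hmult
  have hFp := eval_of_mult hz
  clear hz
  have hz := hf.no_common_zero
  have hfh := hf.homog
  obtain ⟨c, hc⟩ := aeval_ne hp
  constructor
  · intro hA
    obtain ⟨v, hv0, hv⟩ := exists_preimage (by omega) hfh hz hFirr hFhom hFf hc hFp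
    obtain ⟨l, hl, hlv⟩ := ab_prop hz hc hv0 hv
    obtain ⟨w, hw⟩ := exists_dual hv0
    have hfc : eval v (f c) ≠ 0 := by rw [hlv]; exact mul_ne_zero hl hc
    obtain ⟨e, he⟩ := hA c hc
    obtain ⟨h1, h2⟩ := fwd_local _ _ m hm (phiHom f v w c) (by
      intro h hh
      obtain ⟨r, rfl⟩ := Ideal.mem_span_singleton.mp hh
      rw [map_mul, phi_dehom f v w c hfc hFhom, hFf, map_zero, mul_zero, zero_mul])
      (phi_cc f v w c p l hl hlv) e he
    have hdvd : ∀ i, linFormOf v ^ 2 ∣ abFun f (affOf p c) c i := by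
      intro i
      rw [theta_dvd_iff hw (ab_hom hfh _ c i), ← ab_order f v w c hfc]
      exact h1 _ (by simp)
    have hgcd := gcd_eq hn hfh hz hFirr hFhom hFf hc hF3 (lin_hom v) (lin_ne hv0) hdvd
    obtain ⟨i, hi⟩ := exact_two hfh hw hdvd (not_cube hc hv0 hgcd)
    rw [← ab_order f v w c hfc] at hi
    obtain ⟨h3, h4⟩ := h2 ⟨_, hi⟩
    have hO2 : OrdSet f v w 2 := (ordSet_iff f v w c hfc 2).mpr ⟨_, hi⟩
    refine ⟨linFormOf v, lin_hom v, lin_ne hv0, hgcd, ?_, ?_⟩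
    · rw [curv_iff f hfh hw p hp l hl hlv hO2]
      intro k hk hO
      obtain ⟨h, hh⟩ := (ordSet_iff f v w c hfc _).mp hO
      exact h3 h k hk hh
    · intro t ht
      rw [curv_iff f hfh hw p hp l hl hlv hO2]
      intro hcon
      exact hcon m ht ((ordSet_iff f v w c hfc _).mpr h4)
  · rintro ⟨L, hL1, hL0, hgcd, hC, hC'⟩
    obtain ⟨v, hv0, rfl⟩ := lin_eq hL1 hL0
    obtain ⟨w, hw⟩ := exists_dual hv0
    have hdvd : ∀ c, p c ≠ 0 → ∀ i, linFormOf v ^ 2 ∣ abFun f (affOf p c) c i := fun c hc =>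
      (cross_dvd_iff f hc _).mp hgcd.1
    have hlin0 : eval v (linFormOf v) = 0 := by simp [linFormOf, mul_comm]
    obtain ⟨l, hl, hlv⟩ := ab_prop hz hc hv0 (by
      intro i
      obtain ⟨r, hr⟩ := hdvd c hc i
      rw [hr, map_mul, map_pow, hlin0]; simp)
    have hfc : ∀ c, p c ≠ 0 → eval v (f c) ≠ 0 := fun c hc => by
      rw [hlv]; exact mul_ne_zero hl hc
    have hex : ∀ c, p c ≠ 0 → ∃ i, (phiHom f v w c (X i - C (affOf p c i))).order = 2 := by
      intro c hc
      obtain ⟨i, hi⟩ := exact_two hfh hw (hdvd c hc) (not_cube hc hv0 hgcd)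
      exact ⟨i, (ab_order f v w c (hfc c hc) _ i).trans hi⟩
    have hO2 : OrdSet f v w 2 := by
      obtain ⟨i, hi⟩ := hex c hc
      exact (ordSet_iff f v w c (hfc c hc) 2).mpr ⟨_, hi⟩
    rw [curv_iff f hfh hw p hp l hl hlv hO2] at hC
    have hC2 := hC' (m + 1) (by omega)
    rw [curv_iff f hfh hw p hp l hl hlv hO2] at hC2
    push Not at hC2
    obtain ⟨k, hk, hOk⟩ := hC2
    have hkm : k = m := by
      by_contra hne
      exact hC k (by omega) hOk
    subst hkm
    intro c hc
    obtain ⟨i, hi⟩ := hex c hc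
    obtain ⟨j, hij⟩ : ∃ j : Fin 2, ∀ k, k = i ∨ k = j := by
      fin_cases i
      · exact ⟨1, by decide⟩
      · exact ⟨0, by decide⟩
    exact rev_local k hm (affOf p c) _ (phiHom f v w c)
      (by rw [phi_dehom f v w c (hfc c hc) hFhom, hFf, map_zero, mul_zero])
      (phi_cc f v w c p l hl hlv) (not_mem_cube hc hn hFhom hF3)
      (X i - C (affOf p c i)) (X j - C (affOf p c j)) (adj_top _ i j hij) hi
      (fun h k' hk' hh => hC k' hk' ((ordSet_iff f v w c (hfc c hc) _).mpr ⟨h, hh⟩))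
      ((ordSet_iff f v w c (hfc c hc) _).mp hOk)

/-- Let `P` be a double point of `C` and `m ≥ 1`. Then `P` is an `A_{2m}` singularity iff
`G_P = L²` for a linear form `L` and `m` is the largest `t ≥ 1` such that the local ring at
`P` of the ideal `J_t` (generated by the homogeneous `h` with `L^{2t} ∣ h(f₀,f₁,f₂)`) is
isomorphic as a `K`-algebra to `K[u]/(u^t)`. -/
theorem statement_16 {K : Type*} [Field K] [IsAlgClosed K] [CharZero K]
    (n : ℕ) (hn : 3 ≤ n) (f : Fin 3 → MvPolynomial (Fin 2) K)
    (hf : IsProperParam n f)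
    (F : MvPolynomial (Fin 3) K) (hFirr : Irreducible F) (hFhom : F.IsHomogeneous n)
    (hFf : MvPolynomial.aeval f F = 0)
    (p : Fin 3 → K) (hp : p ≠ 0) (hmult : multAt F p = 2)
    (m : ℕ) (hm : 1 ≤ m) :
    IsAsSing F p (2 * m) ↔
      ∃ L : MvPolynomial (Fin 2) K,
        L.IsHomogeneous 1 ∧ L ≠ 0 ∧
        IsGcdOfCross f p (L ^ 2) ∧
        CurvilinearOfLength (JIdeal f (L ^ (2 * m))) p m ∧
        (∀ t : ℕ, m < t → ¬ CurvilinearOfLength (JIdeal f (L ^ (2 * t))) p t) := by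
  exact main_iff n hn f hf F hFirr hFhom hFf p hp hmult m hm

end
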